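/- For every integer n ≥ 2 there exists an infinite word w : ℕ → {1,…,n} such that every finite factor of w having a period q ≥ 1 has length at most q·RT(n), where RT(2) = 2, RT(3) = 7/4, RT(4) = 7/5, and RT(n) = n/(n−1) for n ≥ 5. (This is the avoidance direction of Dejean's conjecture, which the paper asserts now holds for all n ≥ 2.) -/

import Mathlib

/-- The factor of the infinite word `w` starting at position `i`, of length `L`. -/
def wordOf {α : Type*} (w : ℕ → α) (i L : ℕ) : List α :=
  (List.range L).map fun k => w (i + k)

/-- The finite word `u` has period `q`: `u_i = u_{i+q}` for all valid indices. -/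
def HasPeriodL {α : Type*} (u : List α) (q : ℕ) : Prop :=
  ∀ i, i + q < u.length → u[i]? = u[i + q]?

/-- Dejean's repetitive threshold. -/
def RT (n : ℕ) : ℚ :=
  if n = 2 then 2 else if n = 3 then 7 / 4 else if n = 4 then 7 / 5 else (n : ℚ) / ((n : ℚ) - 1)

namespace Dejean

/-- The positions `p, …, p + e - 1` of `w` carry the same letters as their translates by `q`. -/
def Match {α : Type*} (w : ℕ → α) (p q e : ℕ) : Prop :=
  ∀ k < e, w (p + k) = w (p + q + k)

/-- The two elementary moves of Pansiot's coding on `M + 1` letters: both shift a window of `M`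
distinct letters; `false` re-enters the letter that leaves, `true` enters the spare letter. -/
def move (M : ℕ) (a : Bool) : Equiv.Perm (Fin (M + 1)) :=
  if a then finRotate (M + 1) else Equiv.swap 0 (Fin.last M) * finRotate (M + 1)

/-- The arrangement of the letters after reading `p` letters of the code `b`. -/
def state (M : ℕ) (b : ℕ → Bool) : ℕ → Equiv.Perm (Fin (M + 1))
  | 0 => 1
  | p + 1 => state M b p * move M (b p)

/-- The word with Pansiot code `b`. -/
def decode (M : ℕ) (b : ℕ → Bool) (p : ℕ) : Fin (M + 1) := state M b p 0

/-- The action of `move` on numbers. -/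
def moveNat (M : ℕ) (a : Bool) (k : ℕ) : ℕ :=
  bif Nat.blt (k + 1) M then k + 1
  else bif Nat.beq (k + 1) M then (bif a then M else 0) else (bif a then 0 else M)

theorem moveNat_eq (M : ℕ) (a : Bool) (k : ℕ) :
    moveNat M a k = if k + 1 < M then k + 1
      else if k + 1 = M then (if a then M else 0) else (if a then 0 else M) := by
  have h1 : Nat.blt (k + 1) M = decide (k + 1 < M) := by
    rw [Bool.eq_iff_iff, Nat.blt_eq, decide_eq_true_iff]
  have h2 : Nat.beq (k + 1) M = decide (k + 1 = M) := by
    rw [Bool.eq_iff_iff, Nat.beq_eq, decide_eq_true_iff]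
  rw [moveNat, h1, h2]
  simp only [Bool.cond_eq_ite, decide_eq_true_eq]

theorem val_move (M : ℕ) (a : Bool) (k : Fin (M + 1)) :
    (move M a k : ℕ) = moveNat M a k := by
  have key : (finRotate (M + 1) k : ℕ) = if (k : ℕ) = M then (0 : ℕ) else (k : ℕ) + 1 := by
    rcases eq_or_ne k (Fin.last M) with rfl | h
    · simp
    · rw [coe_finRotate_of_ne_last h, if_neg]
      exact fun h' => h (Fin.ext h')
  have hk := k.isLt
  rw [moveNat_eq]
  unfold move
  cases a
  · simp only [Bool.false_eq_true, if_false, Equiv.Perm.mul_apply]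
    rw [Equiv.swap_apply_def]
    simp only [Fin.ext_iff, Fin.val_zero, Fin.val_last, key]
    split_ifs <;> grind
  · simp only [if_true]
    rw [key]
    split_ifs <;> omega

theorem val_move_of_lt (M : ℕ) (a : Bool) (k : Fin (M + 1)) (h : (k : ℕ) + 1 < M) :
    (move M a k : ℕ) = k + 1 := by
  rw [val_move M, moveNat_eq, if_pos h]

theorem move_injective (M : ℕ) (hM : 1 ≤ M) : Function.Injective (move M) := by
  intro a a' h
  have h1 := congrArg (fun g : Equiv.Perm (Fin (M + 1)) => (g (Fin.last M) : ℕ)) h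
  simp only [val_move M, moveNat_eq, Fin.val_last] at h1
  cases a <;> cases a' <;> simp at h1 ⊢ <;> omega

theorem state_add (M : ℕ) (b : ℕ → Bool) (p k : ℕ) :
    state M b (p + k) = state M b p * state M (fun i => b (p + i)) k := by
  induction k with
  | zero => simp [state]
  | succ k ih => rw [← Nat.add_assoc, state, ih, state, mul_assoc]

theorem state_congr (M : ℕ) {b b' : ℕ → Bool} {k : ℕ} (h : ∀ i < k, b i = b' i) :
    state M b k = state M b' k := by
  induction k with
  | zero => rfl
  | succ k ih => rw [state, state, ih fun i hi => h i (by omega), h k (by omega)]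

theorem state_succ_left (M : ℕ) (b : ℕ → Bool) (k : ℕ) :
    state M b (k + 1) = move M (b 0) * state M (fun i => b (1 + i)) k := by
  rw [Nat.add_comm k 1, state_add]
  simp [state]

theorem state_apply_zero (M : ℕ) (b : ℕ → Bool) (k : ℕ) (hk : k < M) :
    (state M b k 0 : ℕ) = k := by
  induction k generalizing b with
  | zero => simp [state]
  | succ k ih =>
    rw [state_succ_left, Equiv.Perm.mul_apply, val_move_of_lt, ih _ (by omega)]
    rw [ih _ (by omega)]
    exact hk

theorem decode_add (M : ℕ) (b : ℕ → Bool) (p k : ℕ) (hk : k < M) :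
    decode M b (p + k) = state M b p ⟨k, by omega⟩ := by
  rw [decode, state_add, Equiv.Perm.mul_apply]
  congr 1
  exact Fin.ext (state_apply_zero M _ k hk)

theorem perm_eq_of_eqOn {M : ℕ} (g h : Equiv.Perm (Fin (M + 1)))
    (H : ∀ k : Fin (M + 1), (k : ℕ) < M → g k = h k) : g = h := by
  have key : ∀ k, k ≠ Fin.last M → g k = h k := fun k hk =>
    H k (lt_of_le_of_ne (Nat.lt_succ_iff.mp k.isLt) fun h' => hk (Fin.ext h'))
  ext1 k
  by_cases hk : k = Fin.last M
  · by_contra hne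
    obtain ⟨x, hx⟩ := h.surjective (g k)
    by_cases hx' : x = Fin.last M
    · rw [hx', ← hk] at hx
      exact hne hx.symm
    · rw [← key x hx'] at hx
      exact hx' ((g.injective hx).trans hk)
  · exact key k hk

theorem state_eq_of_match {M : ℕ} {b : ℕ → Bool} {p q e : ℕ} (h : Match (decode M b) p q (M + e))
    (k : ℕ) (hk : k ≤ e) : state M b (p + k) = state M b (p + q + k) := by
  refine perm_eq_of_eqOn _ _ fun i hi => ?_
  have := h (k + i) (by omega)
  rwa [← Nat.add_assoc, ← Nat.add_assoc, decode_add M b _ _ hi, decode_add M b _ _ hi] at this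

theorem code_eq_of_match {M : ℕ} (hM : 1 ≤ M) {b : ℕ → Bool} {p q e : ℕ}
    (h : Match (decode M b) p q (M + e)) : Match b p q e := by
  intro k hk
  have h1 := state_eq_of_match h k hk.le
  have h2 := state_eq_of_match h (k + 1) hk
  rw [← Nat.add_assoc, ← Nat.add_assoc, state, state, h1] at h2
  exact move_injective M hM (mul_left_cancel h2)

theorem match_of_state_eq {M : ℕ} {b : ℕ → Bool} {p q s : ℕ}
    (h : state M b p = state M b (p + q)) (hs : Match b p q s) :
    Match (decode M b) p q (M + s) := by
  have key : ∀ k ≤ s, state M b (p + k) = state M b (p + q + k) := by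
    intro k hk
    rw [state_add, state_add, h, state_congr M (fun i hi => hs i (by omega))]
  intro k hk
  by_cases hks : k ≤ s
  · rw [decode, decode, key k hks]
  · obtain ⟨i, rfl⟩ := Nat.exists_eq_add_of_le (show s ≤ k by omega)
    rw [← Nat.add_assoc, ← Nat.add_assoc, decode_add M b _ _ (by omega),
      decode_add M b _ _ (by omega), key s le_rfl]

/-- The fixed point, starting with `true`, of the `L`-uniform morphism whose images are the first
`L` binary digits of `f false` and `f true`. -/
def code (L : ℕ) (f : Bool → ℕ) (p : ℕ) : Bool :=
  if _h : p = 0 ∨ L < 2 then true else (f (code L f (p / L))).testBit (p % L)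
termination_by p
decreasing_by exact Nat.div_lt_self (by omega) (by omega)

theorem code_eq {L : ℕ} {f : Bool → ℕ} (hL : 2 ≤ L) (hf : (f true).testBit 0 = true) (p : ℕ) :
    code L f p = (f (code L f (p / L))).testBit (p % L) := by
  rcases Nat.eq_zero_or_pos p with rfl | hp
  · have : code L f 0 = true := by rw [code]; simp
    simp [this, hf]
  · rw [code, dif_neg (by omega)]

theorem code_mul_add {L : ℕ} {f : Bool → ℕ} (hL : 2 ≤ L) (hf : (f true).testBit 0 = true)
    (P r : ℕ) (hr : r < L) : code L f (L * P + r) = (f (code L f P)).testBit r := by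
  rw [code_eq hL hf, Nat.mul_add_div (by omega), Nat.div_eq_of_lt hr, Nat.mul_add_mod,
    Nat.mod_eq_of_lt hr, Nat.add_zero]

theorem state_code_mul {M L : ℕ} {f : Bool → ℕ} (hL : 2 ≤ L) (hf : (f true).testBit 0 = true)
    {τ : Equiv.Perm (Fin (M + 1))}
    (hτ : ∀ a, state M (fun i => (f a).testBit i) L = τ * move M a * τ⁻¹) (P : ℕ) :
    state M (code L f) (L * P) = τ * state M (code L f) P * τ⁻¹ := by
  induction P with
  | zero => simp [state]
  | succ P ih =>
    rw [Nat.mul_succ, state_add, ih, state,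
      state_congr M (b' := fun i => (f (code L f P)).testBit i)
        fun i hi => code_mul_add hL hf P i hi, hτ]
    group

/-- Cancelling a common factor of the code from a pair of equal states. -/
theorem state_eq_of_add {M : ℕ} {b : ℕ → Bool} {p q r : ℕ}
    (h : state M b (p + r) = state M b (q + r)) (hb : ∀ i < r, b (p + i) = b (q + i)) :
    state M b p = state M b q := by
  rw [state_add, state_add, state_congr M hb] at h
  exact mul_right_cancel h

theorem state_add_eq {M : ℕ} {b : ℕ → Bool} {p q r : ℕ}
    (h : state M b p = state M b q) (hb : ∀ i < r, b (p + i) = b (q + i)) :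
    state M b (p + r) = state M b (q + r) := by
  rw [state_add, state_add, state_congr M hb, h]

/-- Either two sequences agree forever, or there is a first difference. -/
theorem exists_first_ne (b c : ℕ → Bool) (s : ℕ) :
    (∀ i < s, b i = c i) ∨ ∃ t < s, (∀ i < t, b i = c i) ∧ b t ≠ c t := by
  induction s with
  | zero => left; intro i hi; omega
  | succ s ih =>
    rcases ih with h | ⟨t, ht, h⟩
    · by_cases hs : b s = c s
      · left
        intro i hi
        rcases Nat.lt_succ_iff_lt_or_eq.mp hi with hi | rfl
        exacts [h i hi, hs]
      · exact Or.inr ⟨s, by omega, h, hs⟩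
    · exact Or.inr ⟨t, by omega, h⟩

/-- Desubstitution: a long match whose period is a multiple of `L` comes from a match of the
preimage. -/
theorem exists_match_div {M L S : ℕ} {f : Bool → ℕ} (hL : 2 ≤ L)
    (hM : 1 ≤ M) (hf : (f true).testBit 0 = true) {τ : Equiv.Perm (Fin (M + 1))}
    (hτ : ∀ a, state M (fun i => (f a).testBit i) L = τ * move M a * τ⁻¹)
    {x₀ : ℕ} (hx₀ : x₀ < L) (hne : (f false).testBit x₀ ≠ (f true).testBit x₀)
    (hmid : ∀ x y, x + S ≤ y → y < L →
      (∀ k, x ≤ k → k < y → (f false).testBit k = (f true).testBit k) →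
      (∀ k < y, (f false).testBit k = (f true).testBit k) ∨
      (∀ k, x ≤ k → k < L → (f false).testBit k = (f true).testBit k))
    {p Q E : ℕ} (h : Match (decode M (code L f)) p (L * Q) (M + E)) (hE : S ≤ E) :
    ∃ P s, Match (decode M (code L f)) P Q (M + s) ∧ E < L * (s + 1) := by
  set b := code L f with hb
  have hst := state_eq_of_match h
  have hcd := code_eq_of_match hM h
  have hbL : ∀ P r, r < L → b (L * P + r) = (f (b P)).testBit r := code_mul_add hL hf
  have hne' : ∀ P P', b P ≠ b P' → (f (b P)).testBit x₀ ≠ (f (b P')).testBit x₀ := by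
    intro P P' hPP
    cases h1 : b P <;> cases h2 : b P' <;> simp_all [Ne.symm]
  have hagree : ∀ P P' k, (f false).testBit k = (f true).testBit k →
      (f (b P)).testBit k = (f (b P')).testBit k := by
    intro P P' k hk
    cases h1 : b P <;> cases h2 : b P' <;> simp_all
  have hagree' : ∀ P P' k, b P ≠ b P' → (f (b P)).testBit k = (f (b P')).testBit k →
      (f false).testBit k = (f true).testBit k := by
    intro P P' k hPP hk
    cases h1 : b P <;> cases h2 : b P' <;> simp_all
  -- it suffices to find a block boundary with equal states
  have main : ∀ P, state M b (L * P) = state M b (L * (P + Q)) → L * P ≤ p + E →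
      p ≤ L * P + L → (p ≤ L * P + x₀ ∨ b P = b (P + Q)) → L * P ≤ p + (L - 1 - x₀) →
      ∃ P s, Match (decode M b) P Q (M + s) ∧ E < L * (s + 1) := by
    intro P hP hPE hPp hPx hPl
    rw [state_code_mul hL hf hτ, state_code_mul hL hf hτ] at hP
    have hP' := mul_left_cancel (mul_right_cancel hP)
    rcases exists_first_ne (fun i => b (P + i)) (fun i => b (P + Q + i)) (E + 1) with
      hs | ⟨s, -, hs, hsne⟩
    · refine ⟨P, E + 1, match_of_state_eq hP' hs, ?_⟩
      nlinarith
    · refine ⟨P, s, match_of_state_eq hP' hs, ?_⟩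
      by_contra hlt
      -- the position `L * (P + s) + x₀` lies in the match
      have h1 : p ≤ L * (P + s) + x₀ := by
        rcases hPx with hPx | hPx
        · nlinarith
        · rcases Nat.eq_zero_or_pos s with rfl | hs0
          · simp at hsne; exact absurd hPx hsne
          · nlinarith
      obtain ⟨k, hk⟩ := Nat.exists_eq_add_of_le h1
      have h2 : k < E := by
        have : L * (P + s) = L * P + L * s := by ring
        have : L * (s + 1) = L * s + L := by ring
        omega
      have h3 := hcd k h2
      rw [show p + L * Q + k = L * (P + Q + s) + x₀ by
        have : L * (P + Q + s) = L * (P + s) + L * Q := by ring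
        omega, ← hk, hbL _ _ hx₀, hbL _ _ hx₀] at h3
      exact hne' _ _ hsne h3
  obtain ⟨P, r, hr, rfl⟩ : ∃ P r, r < L ∧ p = L * P + r :=
    ⟨p / L, p % L, Nat.mod_lt _ (by omega), (Nat.div_add_mod p L).symm⟩
  have hLQ : L * (P + Q) = L * P + L * Q := by ring
  have h0 : state M b (L * P + r) = state M b (L * (P + Q) + r) := by
    have := hst 0 (Nat.zero_le _)
    rwa [Nat.add_zero (L * P + r), Nat.add_zero (L * P + r + L * Q), Nat.add_right_comm, ← hLQ]
      at this
  have hrun : ∀ k, r ≤ k → k < r + E → k < L →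
      (f (b P)).testBit k = (f (b (P + Q))).testBit k := by
    intro k h1 h2 h3
    have := hcd (k - r) (by omega)
    rwa [show L * P + r + (k - r) = L * P + k by omega,
      show L * P + r + L * Q + (k - r) = L * (P + Q) + k by rw [hLQ]; omega,
      hbL _ _ h3, hbL _ _ h3] at this
  by_cases hPQ : b P = b (P + Q)
  · refine main P (state_eq_of_add h0 fun i hi => ?_) (by omega) (by omega) (Or.inr hPQ) (by omega)
    rw [hbL _ _ (by omega), hbL _ _ (by omega), hPQ]
  have hout : x₀ < r ∨ r + E ≤ x₀ := by
    by_contra! hcon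
    exact hne' _ _ hPQ (hrun x₀ hcon.1 hcon.2 hx₀)
  have hrun' : ∀ k, r ≤ k → k < r + E → k < L → (f false).testBit k = (f true).testBit k :=
    fun k h1 h2 h3 => hagree' _ _ _ hPQ (hrun k h1 h2 h3)
  rcases hout with hout | hout
  · have hsuf : ∀ k, r ≤ k → k < L → (f false).testBit k = (f true).testBit k := by
      by_cases hrE : r + E < L
      · rcases hmid r (r + E) (by omega) hrE (fun k h1 h2 => hrun' k h1 h2 (by omega)) with h1 | h1
        · exact absurd (h1 x₀ (by omega)) hne
        · exact h1
      · exact fun k h1 h2 => hrun' k h1 (by omega) h2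
    have h1 : L * (P + 1) = L * P + r + (L - r) := by
      have : L * (P + 1) = L * P + L := by ring
      omega
    have h2 : L * (P + 1 + Q) = L * (P + Q) + r + (L - r) := by
      have : L * (P + 1 + Q) = L * (P + Q) + L := by ring
      omega
    have h3 : state M b (L * (P + 1)) = state M b (L * (P + 1 + Q)) := by
      rw [h1, h2]
      refine state_add_eq h0 fun i hi => ?_
      rw [Nat.add_assoc, Nat.add_assoc, hbL _ _ (by omega), hbL _ _ (by omega)]
      exact hagree _ _ _ (hsuf _ (by omega) (by omega))
    by_cases hrE : L ≤ r + E
    · exact main (P + 1) h3 (by omega) (by omega) (Or.inl (by omega)) (by omega)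
    · refine ⟨P + 1, 0, match_of_state_eq ?_ (fun k hk => by omega), by omega⟩
      rw [state_code_mul hL hf hτ, state_code_mul hL hf hτ] at h3
      exact mul_left_cancel (mul_right_cancel h3)
  · rcases hmid r (r + E) (by omega) (by omega) (fun k h1 h2 => hrun' k h1 h2 (by omega)) with h1 | h1
    · refine main P (state_eq_of_add h0 fun i hi => ?_) (by omega) (by omega) (Or.inl (by omega))
        (by omega)
      rw [hbL _ _ (by omega), hbL _ _ (by omega)]
      exact hagree _ _ _ (h1 i (by omega))
    · exact absurd (h1 x₀ (by omega) hx₀) hne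

/-- Bounding all matches of the fixed point from the bounds on the short ones. -/
theorem match_bound {M L S S' num den : ℕ} {f : Bool → ℕ} (hL : 2 ≤ L)
    (hM : 1 ≤ M) (hf : (f true).testBit 0 = true) {τ : Equiv.Perm (Fin (M + 1))}
    (hτ : ∀ a, state M (fun i => (f a).testBit i) L = τ * move M a * τ⁻¹)
    {x₀ : ℕ} (hx₀ : x₀ < L) (hne : (f false).testBit x₀ ≠ (f true).testBit x₀)
    (hmid : ∀ x y, x + S' ≤ y → y < L →
      (∀ k, x ≤ k → k < y → (f false).testBit k = (f true).testBit k) →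
      (∀ k < y, (f false).testBit k = (f true).testBit k) ∨
      (∀ k, x ≤ k → k < L → (f false).testBit k = (f true).testBit k))
    (hsync : ∀ p q, ¬ L ∣ q → ¬ Match (code L f) p q S)
    (hshort : ∀ p q e, 1 ≤ q → e < M + S → Match (decode M (code L f)) p q e →
      e * den ≤ q * num)
    (hshort' : ∀ p q e, 1 ≤ q → L ∣ q → e < M + S' → Match (decode M (code L f)) p q e →
      e * den ≤ q * num) (q : ℕ) :
    ∀ p e, 1 ≤ q → Match (decode M (code L f)) p q e → e * den ≤ q * num := by
  induction q using Nat.strong_induction_on with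
  | _ q ih =>
  intro p e hq h
  by_cases hd : L ∣ q
  · by_cases he : e < M + S'
    · exact hshort' p q e hq hd he h
    obtain ⟨Q, rfl⟩ := hd
    obtain ⟨E, rfl⟩ := Nat.exists_eq_add_of_le (show M ≤ e by omega)
    obtain ⟨P, s, hm, hs⟩ := exists_match_div hL hM hf hτ hx₀ hne hmid h (by omega)
    have hQ : 1 ≤ Q := Nat.pos_of_mul_pos_left (a := L) (by omega)
    have h1 := ih Q (by nlinarith) P (M + s) hQ hm
    have h2 : M + E ≤ L * (M + s) := by nlinarith
    calc (M + E) * den ≤ L * (M + s) * den := Nat.mul_le_mul_right _ h2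
      _ = L * ((M + s) * den) := by ring
      _ ≤ L * (Q * num) := Nat.mul_le_mul_left _ h1
      _ = L * Q * num := by ring
  · by_cases he : e < M + S
    · exact hshort p q e hq he h
    obtain ⟨E, rfl⟩ := Nat.exists_eq_add_of_le (show M ≤ e by omega)
    exact absurd (fun k hk => code_eq_of_match hM h k (by omega)) (hsync p q hd)

/-- The binary digit `i` of `x`. -/
def bit (x i : ℕ) : Bool := Nat.beq (Nat.mod (Nat.shiftRight x i) 2) 1

/-- The number with `x` binary digits `1`. -/
def ones (x : ℕ) : ℕ := Nat.sub (Nat.pow 2 x) 1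

/-- The `x` lowest binary digits of `y`. -/
def low (x y : ℕ) : ℕ := Nat.mod y (Nat.pow 2 x)

/-- The numbers `h i, …, h (i + 2 ^ k - 1)`, concatenated as blocks of `w` binary digits. -/
def cat (w : ℕ) (h : ℕ → ℕ) (k : ℕ) : ℕ → ℕ :=
  Nat.rec (fun i => low w (h i)) (fun k ih i =>
    Nat.lor (ih i) (Nat.shiftLeft (ih (Nat.add i (Nat.pow 2 k))) (Nat.mul w (Nat.pow 2 k)))) k

theorem cat_zero (w : ℕ) (h : ℕ → ℕ) (i : ℕ) : cat w h 0 i = low w (h i) := rfl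

theorem cat_succ (w : ℕ) (h : ℕ → ℕ) (k i : ℕ) :
    cat w h (k + 1) i = cat w h k i ||| cat w h k (i + 2 ^ k) <<< (w * 2 ^ k) := rfl

/-- The binary digits of `x`, each repeated `g` times. -/
def spread (g x : ℕ) : ℕ := cat g (fun i => bif bit x i then ones g else 0) 10 0

/-- The digit `i` is `1` when one of the digits `i, …, i + e - 1` of `D` is. -/
def orRun (D k : ℕ) : ℕ → ℕ :=
  Nat.rec (fun _ => D) (fun _ ih e => bif Nat.ble e 1 then D else
    (fun m => (fun A => Nat.lor A (Nat.shiftRight A (Nat.sub e m))) (ih m))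
      (Nat.shiftRight (Nat.add e 1) 1)) k

theorem orRun_succ (D k e : ℕ) : orRun D (k + 1) e = bif Nat.ble e 1 then D else
    orRun D k ((e + 1) >>> 1) ||| orRun D k ((e + 1) >>> 1) >>> (e - (e + 1) >>> 1) := rfl

/-- Binary digits of `X` where `B` has digit `1`, and of `Y` elsewhere. -/
def mux (x B X Y : ℕ) : ℕ := Nat.lor (Nat.land B X) (Nat.land (Nat.xor (ones x) B) Y)

/-- `P` holds at `q, q + d, q + 2 d, …`, for at most `2 ^ k` terms below `hi`. -/
def allBelow (P : ℕ → Bool) (hi d k : ℕ) : ℕ → Bool :=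
  Nat.rec (fun q => bif Nat.ble hi q then true else P q) (fun k ih q =>
    bif Nat.ble hi q then true else
      and (ih q) (ih (Nat.add q (Nat.mul d (Nat.pow 2 k))))) k

theorem allBelow_zero (P : ℕ → Bool) (hi d q : ℕ) :
    allBelow P hi d 0 q = bif Nat.ble hi q then true else P q := rfl

theorem allBelow_succ (P : ℕ → Bool) (hi d k q : ℕ) : allBelow P hi d (k + 1) q =
    bif Nat.ble hi q then true else
      (allBelow P hi d k q && allBelow P hi d k (q + d * 2 ^ k)) := rfl

@[simp] theorem lor_eq (a b : ℕ) : Nat.lor a b = a ||| b := rfl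
@[simp] theorem land_eq (a b : ℕ) : Nat.land a b = a &&& b := rfl
@[simp] theorem xor_eq (a b : ℕ) : Nat.xor a b = a ^^^ b := rfl
@[simp] theorem shiftLeft_eq (a b : ℕ) : Nat.shiftLeft a b = a <<< b := rfl
@[simp] theorem shiftRight_eq (a b : ℕ) : Nat.shiftRight a b = a >>> b := rfl

@[simp] theorem bit_eq (x i : ℕ) : bit x i = x.testBit i := by
  unfold bit
  rw [Bool.eq_iff_iff, Nat.beq_eq, Nat.testBit_eq_decide_div_mod_eq, decide_eq_true_iff,
    shiftRight_eq, Nat.shiftRight_eq_div_pow]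
  rfl

@[simp] theorem testBit_ones (x i : ℕ) : (ones x).testBit i = decide (i < x) :=
  Nat.testBit_two_pow_sub_one x i

@[simp] theorem testBit_low (x y i : ℕ) : (low x y).testBit i = (decide (i < x) && y.testBit i) :=
  Nat.testBit_mod_two_pow y x i

theorem cat_lt (w : ℕ) (h : ℕ → ℕ) (k i : ℕ) : cat w h k i < 2 ^ (w * 2 ^ k) := by
  induction k generalizing i with
  | zero => exact Nat.mod_lt (h i) (Nat.two_pow_pos w) |>.trans_eq (by simp)
  | succ k ih =>
    have h1 : w * 2 ^ (k + 1) = w * 2 ^ k + w * 2 ^ k := by ring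
    rw [cat_succ]
    refine Nat.or_lt_two_pow ((ih i).trans_le (Nat.pow_le_pow_right two_pos (by omega))) ?_
    rw [Nat.shiftLeft_eq, h1, pow_add]
    exact Nat.mul_lt_mul_of_pos_right (ih _) (Nat.two_pow_pos _)

theorem testBit_cat (w : ℕ) (h : ℕ → ℕ) (k i u r : ℕ) (hu : u < 2 ^ k) (hr : r < w) :
    (cat w h k i).testBit (w * u + r) = (h (i + u)).testBit r := by
  induction k generalizing i u with
  | zero =>
    obtain rfl : u = 0 := by simpa using hu
    simp [cat_zero, hr]
  | succ k ih =>
    simp only [cat_succ, Nat.testBit_or, Nat.testBit_shiftLeft]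
    by_cases hk : u < 2 ^ k
    · have h1 : w * (u + 1) ≤ w * 2 ^ k := Nat.mul_le_mul_left _ hk
      have h2 : ¬ w * u + r ≥ w * 2 ^ k := by rw [Nat.mul_succ] at h1; omega
      rw [ih i u hk]
      simp [show ¬ w * 2 ^ k ≤ w * u + r from h2]
    · obtain ⟨v, rfl⟩ := Nat.exists_eq_add_of_le (not_lt.mp hk)
      have h1 : w * (2 ^ k + v) + r = w * 2 ^ k + (w * v + r) := by ring
      rw [Nat.testBit_lt_two_pow ((cat_lt w h k i).trans_le
        (Nat.pow_le_pow_right two_pos (by omega : w * 2 ^ k ≤ w * (2 ^ k + v) + r)))]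
      have h2 : v < 2 ^ k := by rw [pow_succ] at hu; omega
      simp [h1, ih _ v h2, Nat.add_assoc]

theorem testBit_spread {g x i j : ℕ} (hi : i < 1024) (hj : j < g) :
    (spread g x).testBit (g * i + j) = x.testBit i := by
  rw [spread, testBit_cat _ _ _ _ _ _ (by simpa using hi) hj]
  cases h : x.testBit i <;> simp [h, hj]

theorem exists_of_testBit_orRun {D k e i : ℕ} (he : 1 ≤ e) (h : (orRun D k e).testBit i = true) :
    ∃ j < e, D.testBit (i + j) = true := by
  induction k generalizing e i with
  | zero => exact ⟨0, by omega, h⟩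
  | succ k ih =>
    rw [orRun_succ] at h
    by_cases h1 : e ≤ 1
    · rw [Nat.ble_eq_true_of_le h1] at h
      exact ⟨0, by omega, h⟩
    · have h2 : Nat.ble e 1 = false := by
        rw [Bool.eq_false_iff, Ne, Nat.ble_eq]; exact h1
      have hm : (e + 1) >>> 1 = (e + 1) / 2 := rfl
      simp only [h2, cond_false, Nat.testBit_or, Nat.testBit_shiftRight, Bool.or_eq_true, hm] at h
      rcases h with h | h
      · obtain ⟨j, hj, hD⟩ := ih (by omega) h
        exact ⟨j, by omega, hD⟩
      · obtain ⟨j, hj, hD⟩ := ih (by omega) h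
        exact ⟨e - (e + 1) / 2 + j, by omega, by rw [← hD]; congr 1; omega⟩

theorem testBit_mux {x B X Y i : ℕ} (hi : i < x) :
    (mux x B X Y).testBit i = if B.testBit i then X.testBit i else Y.testBit i := by
  cases h : B.testBit i <;> simp [mux, h, hi]

theorem of_allBelow {P : ℕ → Bool} {hi d k q : ℕ} (h : allBelow P hi d k q = true) (i : ℕ)
    (hik : i < 2 ^ k) (hi' : q + d * i < hi) : P (q + d * i) = true := by
  induction k generalizing q i with
  | zero =>
    obtain rfl : i = 0 := by simpa using hik
    have h2 : Nat.ble hi q = false := by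
      rw [Bool.eq_false_iff, Ne, Nat.ble_eq]; omega
    simpa [allBelow_zero, h2] using h
  | succ k ih =>
    have h2 : Nat.ble hi q = false := by
      rw [Bool.eq_false_iff, Ne, Nat.ble_eq]
      have := Nat.zero_le (d * i)
      omega
    simp only [allBelow_succ, h2, cond_false, Bool.and_eq_true] at h
    by_cases hk : i < 2 ^ k
    · exact ih h.1 i hk hi'
    · obtain ⟨v, rfl⟩ := Nat.exists_eq_add_of_le (not_lt.mp hk)
      have h1 : q + d * (2 ^ k + v) = q + d * 2 ^ k + d * v := by ring
      rw [h1] at hi' ⊢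
      exact ih h.2 v (by rw [pow_succ] at hik; omega) hi'

/-- A part of the verification of the short matches: the factors of length `r` of the code all
occur between the positions `a` and `a + R` of the image of a short factor, and letters are compared
through `g` of their binary digits. -/
structure Stage where
  (g a R r k hi : ℕ)

/-- A morphism with images of length `L` on Pansiot codes over `M + 1` letters, together with
certificates: every match whose period is not divisible by `L` is shorter than `M + S`, the images
of the two letters differ at `x₀`, and `perm` lists the conjugating permutation in base `64`,
`permInv` its inverse. -/
structure Params where
  (M num den L f₀ f₁ S S' x₀ perm permInv : ℕ)
  (stages stages' : List Stage)

namespace Params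

variable (D : Params)

/-- The images of the letters. -/
def image (a : Bool) : ℕ := bif a then D.f₁ else D.f₀

/-- The image of `1101`, which contains all factors of length two. -/
def base : ℕ := cat D.L (fun j => D.image (bit 11 j)) 2 0

/-- The digits `P` at which the factor of length `r` of `base` differs from the one starting at the
digit `0` of `y`. -/
def miss (y r : ℕ) : ℕ :=
  Nat.rec 0 (fun r ih => Nat.lor ih
    (Nat.xor (Nat.shiftRight D.base r) (bif bit y r then ones (Nat.mul 4 D.L) else 0))) r

/-- The digits at which the factor of length `r` of `base` does not occur at any of the digits
`i, …, i + 2 ^ k - 1` of `base` before `hi`. -/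
def missAll (hi r k : ℕ) : ℕ → ℕ :=
  Nat.rec (fun i => bif Nat.ble (Nat.add i r) hi then D.miss (Nat.shiftRight D.base i) r
    else ones (Nat.mul 4 D.L)) (fun k ih i => Nat.land (ih i) (ih (Nat.add i (Nat.pow 2 k)))) k

end Params

/-- The sequence of spare letters, from the code `Z` and the word `T`. -/
def spares (x g Z T v : ℕ) : ℕ :=
  (fun V => low x (Nat.lor V (Nat.shiftLeft (Nat.land (Nat.xor (ones x) Z) V) g)))
    (low x (Nat.lor v (Nat.shiftLeft (Nat.land Z T) g)))

/-- A decoder for Pansiot codes, by halving; its result is checked afterwards. -/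
def decoder (g M k : ℕ) : ℕ → ℕ → ℕ :=
  Nat.rec (fun Z t =>
    (fun c => (fun T => (fun V => Nat.lor T (Nat.shiftLeft (Nat.lor (mux c Z V T) (Nat.shiftLeft
        (low g (Nat.shiftRight (Nat.lor V (Nat.shiftLeft (mux c Z T V) g)) c)) c)) c))
      (spares c g Z T (low g (Nat.shiftRight t c)))) (low c t)) (Nat.mul g M))
  (fun k ih Z t => bif Nat.beq Z 0 then 0 else
    (fun c => (fun u => Nat.lor (low c u)
        (Nat.shiftLeft (ih (Nat.shiftRight Z c) (Nat.shiftRight u c)) c))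
      (ih (low c Z) t)) (Nat.mul (Nat.mul g M) (Nat.pow 2 k))) k

/-- `T` is the decoding of `Z`, with letters given by blocks of `g` digits of `C`. -/
def isDecoding (x g M C Z T : ℕ) : Bool :=
  (fun v => (fun V => and
      (Nat.beq T (low x (Nat.lor (low (Nat.mul g M) C) (Nat.shiftLeft (mux x Z V T) (Nat.mul g M)))))
      (Nat.beq V (low x (Nat.lor v (Nat.shiftLeft (mux x Z T V) g)))))
    (spares x g Z T v)) (low g (Nat.shiftRight C (Nat.mul g M)))

/-- No match of period `q` is too long. -/
def noMatch (N g num den U T q : ℕ) : Bool :=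
  (fun e => (fun W => Nat.beq (Nat.land W
      (orRun (Nat.xor T (Nat.shiftRight T (Nat.mul g q))) 10 (Nat.mul g e))) W)
    (low (Nat.mul g (Nat.sub (Nat.add N 1) (Nat.add q e))) U))
    (Nat.add (Nat.div (Nat.mul q num) den) 1)

namespace Params

variable (D : Params)

/-- The image of the factor of `base`. -/
def text (s : Stage) : ℕ :=
  (fun c => (fun F₀ F₁ => cat c (fun i => bif bit D.base (Nat.add s.a i) then F₁ else F₀) s.k 0)
    (low c (spread s.g D.f₀)) (low c (spread s.g D.f₁))) (Nat.mul s.g D.L)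

def checkStage (d lo : ℕ) (s : Stage) : Bool :=
  (fun N Z C => (fun x => (fun T => and (Nat.beq (Nat.mod lo d) 0) <| and (Nat.ble 1 s.g) <|
    and (Nat.ble s.r D.L) <| and (Nat.ble s.hi 16384) <| and (Nat.ble s.R (Nat.pow 2 s.k)) <| and
    (Nat.beq (low (Nat.sub (Nat.add (Nat.mul 4 D.L) 1) s.r)
      (D.missAll (Nat.add s.a s.R) s.r 10 s.a)) 0) <| and
    (isDecoding x s.g D.M C Z T) <| and
    (Nat.ble (Nat.add D.L (Nat.add s.hi (Nat.div (Nat.mul s.hi D.num) D.den))) (Nat.mul D.L s.r)) <|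
    allBelow (noMatch N s.g D.num D.den (Nat.div (ones x) (ones s.g)) T) s.hi d 14 lo)
    (low x (decoder s.g D.M (Nat.add s.k 5) (Nat.lor (low x Z) (Nat.pow 2 x)) C))) (Nat.mul s.g N))
    (Nat.mul D.L s.R) (D.text s) (cat s.g (fun i => i) 6 0)

/-- Successive stages check the periods in an arithmetic progression of difference `d`. -/
def checkStages (d hi : ℕ) : ℕ → List Stage → Bool
  | lo, [] => Nat.ble hi lo
  | lo, s :: l => and (D.checkStage d lo s) (checkStages d hi s.hi l)

def checkSync : Bool :=
  allBelow (fun d => or (Nat.beq (Nat.mod d D.L) 0)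
    ((fun W => Nat.beq (Nat.land W (orRun (Nat.xor D.base (Nat.shiftRight D.base d)) 10 D.S)) W)
      (ones (Nat.sub (Nat.add (Nat.mul 4 D.L) 1) (Nat.add d D.S))))) (Nat.mul 4 D.L) 1 13 1

def checkMid : Bool :=
  (fun F => allBelow (fun x => or (not (Nat.beq (low D.S' (Nat.shiftRight F x)) 0)) <|
      or (Nat.beq (low (Nat.add x D.S') F) 0) (Nat.beq (Nat.shiftRight F x) 0)) D.L 1 10 0)
    (Nat.xor D.f₀ D.f₁)

def digit (x i : ℕ) : ℕ := low 6 (Nat.shiftRight x (Nat.mul 6 i))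

/-- The effect of `move` on arrangements of the letters. -/
def moveList (M : ℕ) (a : Bool) (x : ℕ) : ℕ :=
  bif a then Nat.lor (low (Nat.mul 6 M) (Nat.shiftRight x 6)) (Nat.shiftLeft (low 6 x) (Nat.mul 6 M))
  else Nat.lor (low (Nat.mul 6 (Nat.sub M 1)) (Nat.shiftRight x 6))
    (Nat.shiftLeft (Nat.lor (low 6 x) (Nat.shiftLeft (digit x M) 6)) (Nat.mul 6 (Nat.sub M 1)))

/-- The arrangement `state`. -/
def stateList (M c k : ℕ) : ℕ :=
  Nat.rec (cat 6 (fun i => i) 6 0) (fun k ih => moveList M (bit c k) ih) k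

def checkPerm : Bool :=
  (fun x₀ x₁ => allBelow (fun i =>
    and (Nat.ble (digit D.perm i) D.M) <| and (Nat.ble (digit D.permInv i) D.M) <|
    and (Nat.beq (digit D.perm (digit D.permInv i)) i) <|
    and (Nat.beq (digit x₀ (digit D.perm i)) (digit D.perm (moveNat D.M false i)))
    (Nat.beq (digit x₁ (digit D.perm i)) (digit D.perm (moveNat D.M true i))))
    (Nat.add D.M 1) 1 6 0) (stateList D.M D.f₀ D.L) (stateList D.M D.f₁ D.L)

def checkBasic : Bool :=
  and (Nat.ble 2 D.L) <| and (Nat.ble D.L 1023) <| and (Nat.ble 1 D.M) <| and (Nat.ble D.M 63) <|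
  and (Nat.ble 1 D.num) <|
  and (Nat.ble 1 D.S) <| and (Nat.ble D.S D.L) <| and (bit D.f₁ 0) <| and (Nat.ble (Nat.add D.x₀ 1) D.L) <|
  and (xor (bit D.f₀ D.x₀) (bit D.f₁ D.x₀)) <|
  Nat.beq (low (Nat.sub (Nat.mul 4 D.L) 1) (Nat.lor D.base (Nat.shiftRight D.base 1)))
    (ones (Nat.sub (Nat.mul 4 D.L) 1))

/-- The periods which allow matches of length `M + S - 1` are those from `bound S` on. -/
def bound (S : ℕ) : ℕ :=
  Nat.add (Nat.div (Nat.mul (Nat.sub (Nat.add D.M S) 1) D.den) D.num) 1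

def check : Bool :=
  and D.checkBasic <| and D.checkSync <| and D.checkMid <| and D.checkPerm <|
  and (D.checkStages 1 (D.bound D.S) 1 D.stages) <|
    D.checkStages D.L (D.bound D.S')
      (Nat.mul D.L (Nat.div (Nat.sub (Nat.add (D.bound D.S) D.L) 1) D.L)) D.stages'

end Params

theorem eq_mul_add_mod (p L : ℕ) (hL : 1 ≤ L) : ∃ P r, r < L ∧ p = L * P + r :=
  ⟨p / L, p % L, Nat.mod_lt _ hL, (Nat.div_add_mod p L).symm⟩

/-- A match only depends on the code. -/
theorem match_of_code_eq {M : ℕ} {b b' : ℕ → Bool} {p A q e : ℕ}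
    (hb : ∀ k < q + e, b (p + k) = b' (A + k)) (h : Match (decode M b) p q e) :
    Match (decode M b') A q e := by
  have key : ∀ k ≤ q + e, state M (fun i => b' (A + i)) k = state M (fun i => b (p + i)) k :=
    fun k hk => state_congr M fun i hi => (hb i (by omega)).symm
  intro k hk
  have h1 := h k hk
  rw [decode, decode, Nat.add_assoc p q k, state_add, state_add, Equiv.Perm.mul_apply,
    Equiv.Perm.mul_apply] at h1
  rw [decode, decode, Nat.add_assoc A q k, state_add, state_add, Equiv.Perm.mul_apply,
    Equiv.Perm.mul_apply, key k (by omega), key (q + k) (by omega)]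
  exact congrArg _ ((state M b p).injective h1)

namespace Params

variable (D : Params)

theorem testBit_base {j r : ℕ} (hj : j < 4) (hr : r < D.L) :
    D.base.testBit (D.L * j + r) = (D.image (bit 11 j)).testBit r := by
  rw [base, testBit_cat _ _ _ _ _ _ (by simpa using hj) hr, Nat.zero_add]

/-- What `checkBasic` verifies. -/
structure Basic : Prop where
  two_le : 2 ≤ D.L
  L_le : D.L ≤ 1023
  one_le : 1 ≤ D.M
  M_le : D.M ≤ 63
  num_pos : 1 ≤ D.num
  S_pos : 1 ≤ D.S
  S_le : D.S ≤ D.L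
  one_zero : (D.image true).testBit 0 = true
  x₀_lt : D.x₀ < D.L
  ne : (D.image false).testBit D.x₀ ≠ (D.image true).testBit D.x₀
  base_or : ∀ i < 4 * D.L - 1, D.base.testBit i = true ∨ D.base.testBit (i + 1) = true

variable {D}

theorem basic_of_checkBasic (h : D.checkBasic = true) : D.Basic := by
  simp only [checkBasic, Bool.and_eq_true, Nat.ble_eq, Nat.beq_eq, bit_eq] at h
  obtain ⟨h1, h2, h3, h4, h5, h6, h7, h8, h9, h10, h11⟩ := h
  refine ⟨h1, h2, h3, h4, h5, h6, h7, h8, h9, ?_, fun i hi => ?_⟩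
  · show D.f₀.testBit D.x₀ ≠ D.f₁.testBit D.x₀
    intro h
    rw [h] at h10
    simp at h10
  · have h := congrArg (fun y => Nat.testBit y i) h11
    have hi' : i < Nat.sub (Nat.mul 4 D.L) 1 := hi
    simp only [testBit_low, testBit_ones, hi', lor_eq, shiftRight_eq, Nat.testBit_or,
      Nat.testBit_shiftRight, decide_true, Bool.true_and, Bool.or_eq_true] at h
    rwa [Nat.add_comm 1 i] at h

variable (H : D.Basic)
include H

theorem Basic.code_mul_add (P r : ℕ) (hr : r < D.L) :
    code D.L D.image (D.L * P + r) = (D.image (code D.L D.image P)).testBit r :=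
  Dejean.code_mul_add H.two_le H.one_zero P r hr

/-- Two successive blocks of the code are two successive blocks of `base`. -/
theorem Basic.exists_base_of_or {P : ℕ}
    (hP : code D.L D.image P = true ∨ code D.L D.image (P + 1) = true) :
    ∃ j < 3, ∀ r < 2 * D.L, code D.L D.image (D.L * P + r) = D.base.testBit (D.L * j + r) := by
  have key : ∃ j < 3, bit 11 j = code D.L D.image P ∧ bit 11 (j + 1) = code D.L D.image (P + 1) := by
    cases h : code D.L D.image P <;> cases h' : code D.L D.image (P + 1)
    · simp [h, h'] at hP
    · exact ⟨2, by decide, by decide, by decide⟩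
    · exact ⟨1, by decide, by decide, by decide⟩
    · exact ⟨0, by decide, by decide, by decide⟩
  obtain ⟨j, hj, h1, h2⟩ := key
  refine ⟨j, hj, fun r hr => ?_⟩
  by_cases hr' : r < D.L
  · rw [H.code_mul_add P r hr', D.testBit_base (by omega) hr', h1]
  · obtain ⟨k, rfl⟩ := Nat.exists_eq_add_of_le (not_lt.mp hr')
    rw [← Nat.add_assoc, ← Nat.add_assoc, ← Nat.mul_succ, ← Nat.mul_succ,
      H.code_mul_add _ k (by omega), D.testBit_base (by omega) (by omega), h2]

theorem Basic.code_or (P : ℕ) :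
    code D.L D.image P = true ∨ code D.L D.image (P + 1) = true := by
  induction P using Nat.strong_induction_on with
  | _ p ih =>
  have hL := H.two_le
  rcases Nat.eq_zero_or_pos p with rfl | hp
  · left; rw [code]; simp
  · obtain ⟨P, r, hr, rfl⟩ := eq_mul_add_mod p D.L (by omega)
    have hP : P < D.L * P + r := by
      rcases Nat.eq_zero_or_pos P with rfl | hP
      · omega
      · nlinarith
    obtain ⟨j, hj, h⟩ := H.exists_base_of_or (ih P hP)
    have h1 : D.L * j ≤ D.L * 2 := Nat.mul_le_mul_left _ (by omega)
    rw [Nat.add_assoc, h r (by omega), h (r + 1) (by omega), ← Nat.add_assoc]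
    exact H.base_or _ (by omega)

theorem Basic.exists_base (P : ℕ) :
    ∃ j < 3, ∀ r < 2 * D.L, code D.L D.image (D.L * P + r) = D.base.testBit (D.L * j + r) :=
  H.exists_base_of_or (H.code_or P)

theorem Basic.sync_base (h : D.checkSync = true) {A A' : ℕ} (hA : A < A')
    (hd : ¬ D.L ∣ A' - A) (hA' : A' + D.S ≤ 4 * D.L)
    (hm : ∀ k < D.S, D.base.testBit (A + k) = D.base.testBit (A' + k)) : False := by
  have hL := H.L_le
  have hS := H.S_pos
  obtain ⟨d, rfl⟩ := Nat.exists_eq_add_of_lt hA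
  have h := of_allBelow h d (by norm_num; omega) (show 1 + 1 * d < 4 * D.L by omega)
  have hd' : A + d + 1 - A = 1 + 1 * d := by omega
  rw [hd'] at hd
  simp only [Bool.or_eq_true, Nat.beq_eq] at h
  rcases h with h | h
  · exact hd (Nat.dvd_of_mod_eq_zero h)
  · have h := congrArg (fun y => Nat.testBit y A) h
    have hlt : A < Nat.sub (Nat.add (Nat.mul 4 D.L) 1) (Nat.add (1 + 1 * d) D.S) := by
      show A < 4 * D.L + 1 - (1 + 1 * d + D.S)
      omega
    simp only [land_eq, Nat.testBit_and, testBit_ones, hlt, decide_true, Bool.true_and] at h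
    obtain ⟨k, hk, h⟩ := exists_of_testBit_orRun H.S_pos h
    have := hm k hk
    rw [xor_eq, shiftRight_eq, Nat.testBit_xor, Nat.testBit_shiftRight,
      show 1 + 1 * d + (A + k) = A + d + 1 + k by omega, this] at h
    simp at h

theorem Basic.sync (h : D.checkSync = true) (p q : ℕ) (hq : ¬ D.L ∣ q) :
    ¬ Match (code D.L D.image) p q D.S := by
  intro hm
  have hL := H.two_le
  have hS := H.S_le
  obtain ⟨P, r, hr, hp⟩ := eq_mul_add_mod p D.L (by omega)
  obtain ⟨P', r', hr', hp'⟩ := eq_mul_add_mod (p + q) D.L (by omega)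
  obtain ⟨j, hj, hb⟩ := H.exists_base P
  obtain ⟨j', hj', hb'⟩ := H.exists_base P'
  have h1 : D.L * j ≤ D.L * 2 := Nat.mul_le_mul_left _ (by omega)
  have h2 : D.L * j' ≤ D.L * 2 := Nat.mul_le_mul_left _ (by omega)
  have hm' : ∀ k < D.S, D.base.testBit (D.L * j + r + k) = D.base.testBit (D.L * j' + r' + k) := by
    intro k hk
    rw [Nat.add_assoc, Nat.add_assoc, ← hb _ (by omega), ← hb' _ (by omega), ← Nat.add_assoc,
      ← Nat.add_assoc, ← hp, ← hp']
    exact hm k hk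
  have hrr : r ≠ r' := by
    rintro rfl
    have h3 : q = D.L * P' - D.L * P := by omega
    exact hq (h3 ▸ Nat.dvd_sub (Nat.dvd_mul_right _ _) (Nat.dvd_mul_right _ _))
  have hmod : ∀ i i' : ℕ, D.L * i + r ≠ D.L * i' + r' := by
    intro i i' h
    have := congrArg (· % D.L) h
    simp only [Nat.mul_add_mod, Nat.mod_eq_of_lt hr, Nat.mod_eq_of_lt hr'] at this
    exact hrr this
  rcases lt_trichotomy (D.L * j + r) (D.L * j' + r') with hlt | heq | hlt
  · refine H.sync_base h hlt (fun ⟨c, hc⟩ => hmod (j + c) j' ?_) (by omega) hm'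
    rw [Nat.mul_add]; omega
  · exact hmod _ _ heq
  · refine H.sync_base h hlt (fun ⟨c, hc⟩ => hmod j (j' + c) ?_) (by omega)
      fun k hk => (hm' k hk).symm
    rw [Nat.mul_add]; omega

omit H

theorem mid_of_checkMid (h : D.checkMid = true) (hL : D.L ≤ 1023) (x y : ℕ) (hxy : x + D.S' ≤ y)
    (hy : y < D.L)
    (hk : ∀ k, x ≤ k → k < y → (D.image false).testBit k = (D.image true).testBit k) :
    (∀ k < y, (D.image false).testBit k = (D.image true).testBit k) ∨
      (∀ k, x ≤ k → k < D.L → (D.image false).testBit k = (D.image true).testBit k) := by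
  unfold checkMid at h
  have h := of_allBelow h x (by norm_num; omega) (show 0 + 1 * x < D.L by omega)
  have hF : ∀ k, (Nat.xor D.f₀ D.f₁).testBit k = false ↔
      (D.image false).testBit k = (D.image true).testBit k := by
    intro k
    rw [xor_eq, Nat.testBit_xor, bne_eq_false_iff_eq]
    rfl
  simp only [Bool.or_eq_true, Nat.beq_eq, Bool.not_eq_true', Nat.zero_add, Nat.one_mul,
    ← Bool.not_eq_true, shiftRight_eq] at h
  rcases h with h | h | h
  · refine absurd (Nat.eq_of_testBit_eq fun i => ?_) h
    rw [testBit_low, Nat.zero_testBit, Nat.testBit_shiftRight]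
    by_cases hi : i < D.S'
    · simpa [hi] using (hF _).mpr (hk (x + i) (by omega) (by omega))
    · simp [hi]
  · left
    intro k hky
    by_cases hkx : x ≤ k
    · exact hk k hkx hky
    · have := congrArg (fun z => Nat.testBit z k) h
      rw [← hF]
      simpa [show k < x + D.S' by omega] using this
  · right
    intro k hkx _
    have := congrArg (fun z => Nat.testBit z (k - x)) h
    rw [← hF]
    simpa [Nat.testBit_shiftRight, show x + (k - x) = k by omega] using this

end Params

namespace Params

theorem testBit_digit (x i j : ℕ) :
    (digit x i).testBit j = (decide (j < 6) && x.testBit (6 * i + j)) := by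
  simp [digit, Nat.testBit_shiftRight]

theorem digit_append (n A B i : ℕ) :
    digit (low (6 * n) A ||| B <<< (6 * n)) i = if i < n then digit A i else digit B (i - n) := by
  refine Nat.eq_of_testBit_eq fun j => ?_
  rw [testBit_digit, Nat.testBit_or, testBit_low, Nat.testBit_shiftLeft]
  by_cases hj : j < 6
  · split_ifs with h
    · have h1 : 6 * i + j < 6 * n := by omega
      simp [testBit_digit, hj, h1, not_le.mpr h1]
    · have h1 : ¬ 6 * i + j < 6 * n := by omega
      simp [testBit_digit, hj, h1, not_lt.mp h1, show 6 * i + j - 6 * n = 6 * (i - n) + j by omega]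
  · split_ifs <;> simp [testBit_digit, hj]

theorem digit_shiftRight (x i : ℕ) : digit (x >>> 6) i = digit x (i + 1) :=
  Nat.eq_of_testBit_eq fun j => by
    rw [testBit_digit, testBit_digit, Nat.testBit_shiftRight, Nat.mul_succ]
    congr 2
    omega

theorem digit_low_zero (x : ℕ) : digit (low 6 x) 0 = digit x 0 :=
  Nat.eq_of_testBit_eq fun j => by
    by_cases hj : j < 6 <;> simp [testBit_digit, hj]

theorem digit_moveList {M : ℕ} (hM : 1 ≤ M) (a : Bool) (x k : ℕ) (hk : k ≤ M) :
    digit (moveList M a x) k = digit x (moveNat M a k) := by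
  rw [moveNat_eq]
  cases a
  · have : moveList M false x = low (6 * (M - 1)) (x >>> 6) |||
        (low (6 * 1) (low 6 x) ||| digit x M <<< (6 * 1)) <<< (6 * (M - 1)) := by
      refine Nat.eq_of_testBit_eq fun j => ?_
      simp [moveList]
    have hd : digit (digit x M) 0 = digit x M := Nat.eq_of_testBit_eq fun j => by
      by_cases hj : j < 6 <;> simp [testBit_digit, hj]
    rw [this, digit_append, digit_append, digit_shiftRight]
    by_cases h1 : k + 1 < M
    · simp [h1, show k < M - 1 by omega]
    · by_cases h2 : k + 1 = M
      · simp [h2, show ¬ k < M - 1 by omega, show k - (M - 1) = 0 by omega, digit_low_zero]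
      · obtain rfl : k = M := by omega
        simp [show ¬ k < k - 1 by omega, show k - (k - 1) = 1 by omega, hd]
  · have : moveList M true x = low (6 * M) (x >>> 6) ||| low 6 x <<< (6 * M) := rfl
    rw [this, digit_append, digit_shiftRight]
    by_cases h1 : k + 1 < M
    · simp [h1, show k < M by omega]
    · by_cases h2 : k + 1 = M
      · simp [h2, show k < M by omega]
      · obtain rfl : k = M := by omega
        simp [digit_low_zero]

theorem digit_stateList {M : ℕ} (hM : 1 ≤ M) (hM' : M ≤ 63) (c k : ℕ) (i : Fin (M + 1)) :
    digit (stateList M c k) i = state M (fun i => c.testBit i) k i := by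
  induction k generalizing i with
  | zero =>
    have hi : (i : ℕ) < 2 ^ 6 := by have := i.isLt; norm_num; omega
    refine Nat.eq_of_testBit_eq fun j => ?_
    rw [testBit_digit]
    change (decide (j < 6) && (cat 6 (fun i => i) 6 0).testBit (6 * i + j)) = (i : ℕ).testBit j
    by_cases hj : j < 6
    · simp [hj, testBit_cat 6 (fun i => i) 6 0 i j hi hj]
    · have : (i : ℕ) < 2 ^ j := hi.trans_le (Nat.pow_le_pow_right two_pos (by omega))
      simp [hj, Nat.testBit_lt_two_pow this]
  | succ k ih =>
    change digit (moveList M (bit c k) (stateList M c k)) i = _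
    rw [digit_moveList hM _ _ _ (by omega), bit_eq, ← val_move M, ih]
    rfl

variable {D : Params}

theorem Basic.exists_perm (H : D.Basic) (h : D.checkPerm = true) :
    ∃ τ : Equiv.Perm (Fin (D.M + 1)), ∀ a,
      state D.M (fun i => (D.image a).testBit i) D.L = τ * move D.M a * τ⁻¹ := by
  have key : ∀ i : Fin (D.M + 1), digit D.perm i ≤ D.M ∧ digit D.permInv i ≤ D.M ∧
      digit D.perm (digit D.permInv i) = i ∧
      ∀ a, digit (stateList D.M (D.image a) D.L) (digit D.perm i) =
        digit D.perm (moveNat D.M a i) := by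
    intro i
    have hM := H.M_le
    unfold checkPerm at h
    have h := of_allBelow h i (by norm_num; omega) (show 0 + 1 * (i : ℕ) < D.M + 1 by omega)
    simp only [Bool.and_eq_true, Nat.ble_eq, Nat.beq_eq, Nat.zero_add, Nat.one_mul] at h
    exact ⟨h.1, h.2.1, h.2.2.1, fun a => by cases a; exacts [h.2.2.2.1, h.2.2.2.2]⟩
  let t : Fin (D.M + 1) → Fin (D.M + 1) :=
    fun i => ⟨digit D.perm i, Nat.lt_succ_of_le (key i).1⟩
  have ht : Function.Surjective t := fun i =>
    ⟨⟨digit D.permInv i, Nat.lt_succ_of_le (key i).2.1⟩, Fin.ext (key i).2.2.1⟩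
  refine ⟨Equiv.ofBijective t ⟨Finite.injective_iff_surjective.mpr ht, ht⟩, fun a => ?_⟩
  rw [eq_mul_inv_iff_mul_eq]
  ext i
  rw [Equiv.Perm.mul_apply, Equiv.Perm.mul_apply, ← digit_stateList H.one_le H.M_le]
  change digit (stateList D.M (D.image a) D.L) (digit D.perm i) = digit D.perm (move D.M a i)
  rw [(key i).2.2.2 a, val_move D.M]

theorem miss_succ (y r : ℕ) : D.miss y (r + 1) =
    D.miss y r ||| (D.base >>> r ^^^ (bif bit y r then ones (4 * D.L) else 0)) := rfl

theorem missAll_zero (hi r i : ℕ) : D.missAll hi r 0 i = bif Nat.ble (i + r) hi then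
    D.miss (D.base >>> i) r else ones (4 * D.L) := rfl

theorem missAll_succ (hi r k i : ℕ) : D.missAll hi r (k + 1) i =
    D.missAll hi r k i &&& D.missAll hi r k (i + 2 ^ k) := rfl

theorem eq_of_testBit_miss {y r P : ℕ} (h : (D.miss y r).testBit P = false) (hP : P + r ≤ 4 * D.L)
    (u : ℕ) (hu : u < r) : D.base.testBit (P + u) = y.testBit u := by
  induction r with
  | zero => omega
  | succ r ih =>
    rw [miss_succ, Nat.testBit_or, Bool.or_eq_false_iff] at h
    rcases Nat.lt_succ_iff_lt_or_eq.mp hu with hu | rfl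
    · exact ih h.1 (by omega) hu
    · have h2 := h.2
      rw [Nat.testBit_xor, bne_eq_false_iff_eq, Nat.testBit_shiftRight, Nat.add_comm] at h2
      rw [h2, bit_eq]
      cases y.testBit u <;> simp [show P < 4 * D.L by omega]

theorem exists_of_testBit_missAll {hi r k i P : ℕ} (h : (D.missAll hi r k i).testBit P = false)
    (hr : 1 ≤ r) (hP : P + r ≤ 4 * D.L) :
    ∃ d, i ≤ d ∧ d + r ≤ hi ∧ ∀ u < r, D.base.testBit (P + u) = D.base.testBit (d + u) := by
  induction k generalizing i with
  | zero =>
    rw [missAll_zero] at h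
    cases h1 : Nat.ble (i + r) hi
    · rw [h1, cond_false, testBit_ones] at h
      simp at h
      omega
    · rw [h1, cond_true] at h
      refine ⟨i, le_rfl, Nat.le_of_ble_eq_true h1, fun u hu => ?_⟩
      rw [eq_of_testBit_miss h hP u hu, Nat.testBit_shiftRight]
  | succ k ih =>
    rw [missAll_succ, Nat.testBit_and, Bool.and_eq_false_iff] at h
    rcases h with h | h
    · exact ih h
    · obtain ⟨d, h1, h2⟩ := ih h
      exact ⟨d, (Nat.le_add_right _ _).trans h1, h2⟩

end Params

theorem testBit_ones_div_ones {g : ℕ} (hg : 1 ≤ g) {N p : ℕ} (hp : p < N) :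
    (ones (g * N) / ones g).testBit (g * p) = true := by
  have h1 : 1 < 2 ^ g := Nat.one_lt_two_pow (by omega)
  have key : ∃ c, ones (g * N) = c * ones g ∧ ∀ p < N, c.testBit (g * p) = true := by
    clear hp p
    induction N with
    | zero => exact ⟨0, by simp [ones], fun p hp => by omega⟩
    | succ N ih =>
      obtain ⟨c, hc, h⟩ := ih
      refine ⟨2 ^ g * c + 1, ?_, fun p hp => ?_⟩
      · change 2 ^ (g * N) - 1 = c * (2 ^ g - 1) at hc
        change 2 ^ (g * (N + 1)) - 1 = (2 ^ g * c + 1) * (2 ^ g - 1)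
        have h2 : 2 ^ (g * N) = c * (2 ^ g - 1) + 1 := by
          have := Nat.two_pow_pos (g * N)
          omega
        obtain ⟨x, hx⟩ := Nat.exists_eq_add_of_lt h1
        rw [Nat.mul_succ, pow_add, h2, hx, show 1 + x + 1 - 1 = x + 1 by omega]
        have : (c * (x + 1) + 1) * (1 + x + 1) = ((1 + x + 1) * c + 1) * (x + 1) + 1 := by ring
        omega
      · rw [Nat.testBit_two_pow_mul_add _ h1]
        rcases p with _ | p
        · simp [show 0 < g by omega]
        · rw [Nat.mul_succ, if_neg (by omega), Nat.add_sub_cancel]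
          exact h p (by omega)
  obtain ⟨c, hc, h⟩ := key
  have h2 : 0 < ones g := show 0 < 2 ^ g - 1 by omega
  rw [hc, Nat.mul_div_cancel _ h2]
  exact h p hp

theorem not_match_of_noMatch {N g num den T q : ℕ} (hg : 1 ≤ g)
    (h : noMatch N g num den (ones (g * N) / ones g) T q = true) {α : Type*} {w : ℕ → α}
    (hT : ∀ p p', p < N → p' < N → w p = w p' → ∀ j < g, T.testBit (g * p + j) = T.testBit (g * p' + j))
    {A : ℕ} (hA : A + q + (q * num / den + 1) ≤ N) : ¬ Match w A q (q * num / den + 1) := by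
  intro hm
  have h' : low (g * (N + 1 - (q + (q * num / den + 1)))) (ones (g * N) / ones g) &&&
      orRun (T ^^^ T >>> (g * q)) 10 (g * (q * num / den + 1)) =
      low (g * (N + 1 - (q + (q * num / den + 1)))) (ones (g * N) / ones g) := by
    simp only [noMatch, Nat.beq_eq] at h
    exact h
  clear h
  have he : 1 ≤ q * num / den + 1 := Nat.le_add_left 1 _
  generalize q * num / den + 1 = e at *
  have h1 := congrArg (fun y => Nat.testBit y (g * A)) h'
  have hlt : g * A < g * (N + 1 - (q + e)) := Nat.mul_lt_mul_of_pos_left (by omega) hg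
  simp only [Nat.testBit_and, testBit_low, hlt, testBit_ones_div_ones hg (show A < N by omega),
    decide_true, Bool.true_and] at h1
  obtain ⟨j, hj, h2⟩ := exists_of_testBit_orRun (Nat.mul_pos hg he) h1
  obtain ⟨k, r, hr, rfl⟩ := eq_mul_add_mod j g hg
  have hk : k < e := Nat.lt_of_mul_lt_mul_left (a := g) (by omega)
  have h3 := hT _ _ (by omega) (by omega) (hm k hk) r hr
  rw [Nat.testBit_xor, Nat.testBit_shiftRight,
    show g * A + (g * k + r) = g * (A + k) + r by ring,
    show g * q + (g * (A + k) + r) = g * (A + q + k) + r by ring, ← h3] at h2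
  simp at h2

/-- The words computed from the code `Z` agree with the decoded word and the spare letters. -/
theorem testBit_of_isDecoding {N g M Z T : ℕ} (hM : 1 ≤ M) (hM' : M ≤ 63)
    (h : isDecoding (g * N) g M (cat g (fun i => i) 6 0) Z T = true) {z : ℕ → Bool}
    (hz : ∀ i < N, ∀ j < g, Z.testBit (g * i + j) = z i) {p : ℕ} (hp : p < N) {j : ℕ} (hj : j < g) :
    T.testBit (g * p + j) = (decode M z p : ℕ).testBit j := by
  have hC : ∀ i ≤ M, (cat g (fun i => i) 6 0).testBit (g * i + j) = i.testBit j := fun i hi => by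
    rw [testBit_cat _ _ _ _ _ _ (by norm_num; omega) hj, Nat.zero_add]
  generalize cat g (fun i => i) 6 0 = C at *
  simp only [isDecoding, Bool.and_eq_true, Nat.beq_eq] at h
  obtain ⟨hT, hV⟩ := h
  generalize spares (g * N) g Z T (low g (Nat.shiftRight C (Nat.mul g M))) = V at *
  have key : ∀ p < N, T.testBit (g * p + j) = (decode M z p : ℕ).testBit j ∧
      V.testBit (g * p + j) = (state M z p (Fin.last M) : ℕ).testBit j := by
    intro p
    induction p using Nat.strong_induction_on with
    | _ p ih =>
    intro hp
    have hlt : ∀ i < N, g * i + j < g * N := fun i hi => by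
      have := Nat.mul_le_mul_left g (show i + 1 ≤ N from hi)
      rw [Nat.mul_succ] at this
      omega
    constructor
    · have h1 := congrArg (fun y => Nat.testBit y (g * p + j)) hT
      simp only [testBit_low, hlt p hp, decide_true, Bool.true_and, lor_eq, shiftLeft_eq,
        Nat.testBit_or, Nat.testBit_shiftLeft, Nat.mul_eq] at h1
      rw [h1]
      by_cases hpM : p < M
      · have h2 : g * p + j < g * M := by
          have := Nat.mul_le_mul_left g (show p + 1 ≤ M from hpM)
          rw [Nat.mul_succ] at this
          omega
        rw [decode, state_apply_zero M z p hpM]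
        simp [h2, not_le.mpr h2, hC p hpM.le]
      · obtain ⟨k, rfl⟩ := Nat.exists_eq_add_of_le (not_lt.mp hpM)
        have h2 : g * (M + k) + j = g * M + (g * k + j) := by ring
        have hw : (decode M z (M + k) : ℕ) =
            state M z k (if z k then Fin.last M else 0) := by
          have h3 := decode_add M z (k + 1) (M - 1) (by omega)
          rw [show k + 1 + (M - 1) = M + k by omega, state, Equiv.Perm.mul_apply] at h3
          rw [h3]
          congr 2
          ext
          rw [val_move M, moveNat_eq]
          simp only [show M - 1 + 1 = M by omega, if_true]
          cases z k <;> simp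
        rw [h2, hw, testBit_mux (by have := hlt _ hp; omega)]
        have h4 := ih k (by omega) (by omega)
        have h5 := hz k (by omega) j hj
        rw [Nat.add_sub_cancel_left, h5, h4.1, h4.2]
        cases z k <;> simp [decode]
    · have h1 := congrArg (fun y => Nat.testBit y (g * p + j)) hV
      simp only [testBit_low, hlt p hp, decide_true, Bool.true_and, lor_eq, shiftLeft_eq,
        shiftRight_eq, Nat.testBit_or, Nat.testBit_shiftLeft, Nat.mul_eq] at h1
      rw [h1]
      rcases p with _ | k
      · have h2 := hC M le_rfl
        simpa [hj, hlt 0 hp, state, not_le.mpr hj, Nat.testBit_shiftRight] using h2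
      · have h2 : g * (k + 1) + j = g + (g * k + j) := by ring
        have hw : (state M z (k + 1) (Fin.last M) : ℕ) =
            state M z k (if z k then 0 else Fin.last M) := by
          rw [state, Equiv.Perm.mul_apply]
          congr 2
          ext
          rw [val_move M, moveNat_eq]
          cases z k <;> simp
        rw [h2, hw, testBit_mux (by have := hlt _ hp; omega)]
        have h4 := ih k (by omega) (by omega)
        have h5 := hz k (by omega) j hj
        rw [Nat.add_sub_cancel_left, h5, h4.1, h4.2]
        cases z k <;> simp [decode]
  exact (key p hp).1

namespace Params

variable {D : Params}

theorem Basic.match_le_of_checkStage (H : D.Basic) {d lo : ℕ} {s : Stage}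
    (hd0 : 1 ≤ d) (h : D.checkStage d lo s = true) {p q e : ℕ} (hq : lo ≤ q) (hq' : q < s.hi) (hd : d ∣ q)
    (hm : Match (decode D.M (code D.L D.image)) p q e) : e * D.den ≤ q * D.num := by
  by_contra! hlt
  simp only [checkStage, Bool.and_eq_true, Nat.ble_eq, Nat.beq_eq] at h
  obtain ⟨h0, hg, hrL, hhi, hR, hmiss, hdec, hlen, hall⟩ := h
  obtain ⟨g, a, R, r, k, hi⟩ := s
  dsimp only at *
  have hL := H.two_le
  have hL' := H.L_le
  generalize low (Nat.mul g (Nat.mul D.L R)) (decoder _ _ _ _ _) = T at *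
  replace h0 : lo % d = 0 := h0
  replace hmiss : low (4 * D.L + 1 - r) (D.missAll (a + R) r 10 a) = 0 := hmiss
  replace hR : R ≤ 2 ^ k := hR
  replace hlen : D.L + (hi + hi * D.num / D.den) ≤ D.L * r := hlen
  have hr : 1 ≤ r := by
    rcases Nat.eq_zero_or_pos r with rfl | hr
    · have := (Nat.le_add_right _ _).trans hlen
      omega
    · exact hr
  -- the window
  obtain ⟨p', ρ, hρ, rfl⟩ := eq_mul_add_mod p D.L (by omega)
  obtain ⟨P, σ, hσ, rfl⟩ := eq_mul_add_mod p' D.L (by omega)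
  obtain ⟨j, hj, hb⟩ := H.exists_base P
  have h1 : D.L * j ≤ D.L * 2 := Nat.mul_le_mul_left _ (by omega)
  obtain ⟨c, hac, hcR, hc⟩ := exists_of_testBit_missAll (P := D.L * j + σ) (r := r)
    (hi := a + R) (k := 10) (i := a) (by
      have h2 := congrArg (fun y => Nat.testBit y (D.L * j + σ)) hmiss
      have h3 : D.L * j + σ < 4 * D.L + 1 - r := by omega
      simpa only [testBit_low, h3, decide_true, Bool.true_and, Nat.zero_testBit] using h2)
    hr (by omega)
  obtain ⟨c, rfl⟩ := Nat.exists_eq_add_of_le hac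
  set z : ℕ → Bool := fun i => (D.image (D.base.testBit (a + i / D.L))).testBit (i % D.L) with hz
  have hcode : ∀ i < D.L * r, code D.L D.image (D.L * (D.L * P + σ) + i) = z (D.L * c + i) := by
    intro i hi
    obtain ⟨u, v, hv, rfl⟩ := eq_mul_add_mod i D.L (by omega)
    have hu : u < r := Nat.lt_of_mul_lt_mul_left (a := D.L) (by omega)
    rw [← Nat.add_assoc, ← Nat.mul_add, H.code_mul_add _ _ hv, Nat.add_assoc, hb _ (by omega),
      ← Nat.add_assoc, hc u hu, hz, ← Nat.add_assoc, ← Nat.mul_add]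
    simp only [Nat.mul_add_mod, Nat.mod_eq_of_lt hv, Nat.mul_add_div (show 0 < D.L by omega),
      Nat.div_eq_of_lt hv, Nat.add_zero, Nat.add_assoc]
  -- the word on it
  have hZ : ∀ i < D.L * R, ∀ j < g, (D.text ⟨g, a, R, r, k, hi⟩).testBit (g * i + j) = z i := by
    intro i hi j hj
    obtain ⟨u, v, hv, rfl⟩ := eq_mul_add_mod i D.L (by omega)
    have hu : u < R := Nat.lt_of_mul_lt_mul_left (a := D.L) (by omega)
    have h2 : g * v + j < g * D.L := by
      have := Nat.mul_le_mul_left g (show v + 1 ≤ D.L from hv)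
      rw [Nat.mul_succ] at this
      omega
    rw [show g * (D.L * u + v) + j = g * D.L * u + (g * v + j) by ring, text]
    dsimp only
    rw [Nat.mul_eq, testBit_cat _ _ _ _ _ _ (by omega) h2, hz, Nat.zero_add, bit_eq]
    simp only [Nat.mul_add_mod, Nat.mod_eq_of_lt hv, Nat.mul_add_div (show 0 < D.L by omega),
      Nat.div_eq_of_lt hv, Nat.add_zero, Nat.add_eq]
    cases D.base.testBit (a + u) <;>
      simp [testBit_low, h2, testBit_spread (show v < 1024 by omega) hj, image]
  have hT : ∀ p p', p < D.L * R → p' < D.L * R → decode D.M z p = decode D.M z p' →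
      ∀ j < g, T.testBit (g * p + j) = T.testBit (g * p' + j) := by
    intro p p' hp hp' hpp j hj
    rw [testBit_of_isDecoding H.one_le H.M_le hdec hZ hp hj,
      testBit_of_isDecoding H.one_le H.M_le hdec hZ hp' hj, hpp]
  obtain ⟨i, hi'⟩ : ∃ i, q = lo + d * i := by
    obtain ⟨i, hi⟩ := (Nat.dvd_sub hd (Nat.dvd_of_mod_eq_zero h0) : d ∣ q - lo)
    exact ⟨i, by omega⟩
  have hno := of_allBelow hall i (by
    have : i ≤ d * i := Nat.le_mul_of_pos_left i hd0
    norm_num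
    omega) (by omega)
  rw [← hi'] at hno
  have he : q * D.num / D.den + 1 ≤ e := by
    rcases Nat.eq_zero_or_pos D.den with h2 | h2
    · simp [h2] at hlt
    · exact (Nat.div_lt_iff_lt_mul h2).mpr hlt
  have he' : q * D.num / D.den ≤ hi * D.num / D.den :=
    Nat.div_le_div_right (Nat.mul_le_mul_right _ hq'.le)
  have h3 : D.L * c + D.L * r ≤ D.L * R := by
    rw [← Nat.mul_add]
    exact Nat.mul_le_mul_left _ (by omega)
  refine not_match_of_noMatch (N := D.L * R) hg hno hT (A := D.L * c + ρ) (by omega)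
    (match_of_code_eq (b := code D.L D.image) (p := D.L * (D.L * P + σ) + ρ) (fun i hi => ?_)
      fun i hi => hm i (by omega))
  rw [Nat.add_assoc, hcode _ (by omega), Nat.add_assoc]

theorem Basic.match_le_of_checkStages (H : D.Basic) {d hi lo : ℕ} {l : List Stage}
    (hd0 : 1 ≤ d) (h : D.checkStages d hi lo l = true) {p q e : ℕ} (hq : lo ≤ q) (hq' : q < hi) (hd : d ∣ q)
    (hm : Match (decode D.M (code D.L D.image)) p q e) : e * D.den ≤ q * D.num := by
  induction l generalizing lo with
  | nil => exact absurd (hq'.trans_le (Nat.le_of_ble_eq_true h)) (by omega)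
  | cons s l ih =>
    simp only [checkStages, Bool.and_eq_true] at h
    by_cases hs : q < s.hi
    · exact H.match_le_of_checkStage hd0 h.1 hq hs hd hm
    · exact ih h.2 (by omega)

/-- The word given by checked parameters avoids long matches. -/
theorem match_le_of_check (h : D.check = true) {p q e : ℕ} (hq : 1 ≤ q)
    (hm : Match (decode D.M (code D.L D.image)) p q e) : e * D.den ≤ q * D.num := by
  simp only [check, Bool.and_eq_true] at h
  obtain ⟨hbasic, hsync, hmid, hperm, hst, hst'⟩ := h
  have H := basic_of_checkBasic hbasic
  obtain ⟨τ, hτ⟩ := H.exists_perm hperm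
  have hL := H.two_le
  have hbound : ∀ S q, D.bound S ≤ q → ∀ e < D.M + S, e * D.den ≤ q * D.num := by
    intro S q hq e he
    have h1 : (D.M + S - 1) * D.den / D.num < q := hq
    calc e * D.den ≤ (D.M + S - 1) * D.den := Nat.mul_le_mul_right _ (by omega)
      _ ≤ q * D.num := ((Nat.div_lt_iff_lt_mul H.num_pos).mp h1).le
  have hshort : ∀ p q e, 1 ≤ q → e < D.M + D.S → Match (decode D.M (code D.L D.image)) p q e →
      e * D.den ≤ q * D.num := by
    intro p q e hq he hm
    by_cases hb : q < D.bound D.S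
    · exact H.match_le_of_checkStages le_rfl hst hq hb (one_dvd q) hm
    · exact hbound _ _ (not_lt.mp hb) _ he
  refine match_bound H.two_le H.one_le H.one_zero hτ H.x₀_lt H.ne
    (mid_of_checkMid hmid H.L_le) (H.sync hsync) hshort ?_ q p e hq hm
  intro p q e hq hdvd he hm
  by_cases hb : q < D.bound D.S
  · exact H.match_le_of_checkStages le_rfl hst hq hb (one_dvd q) hm
  by_cases hb' : q < D.bound D.S'
  · refine H.match_le_of_checkStages (by omega) hst' ?_ hb' hdvd hm
    obtain ⟨c, rfl⟩ := hdvd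
    refine Nat.mul_le_mul_left _ (Nat.le_of_lt_succ ?_)
    change (D.bound D.S + D.L - 1) / D.L < c + 1
    rw [Nat.div_lt_iff_lt_mul (by omega), Nat.succ_mul, Nat.mul_comm c]
    omega
  · exact hbound _ _ (not_lt.mp hb') _ he

end Params

/-- Over `n` letters, the length of a repetition exceeds its period `q` by at most `q * num / den`,
for some infinite word. -/
def Avoidable (n num den : ℕ) : Prop :=
  ∃ w : ℕ → Fin n, ∀ p q e, 1 ≤ q → Match w p q e → e * den ≤ q * num

theorem avoidable_of_check (D : Params) (h : D.check = true) :
    Avoidable (D.M + 1) D.num D.den :=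
  ⟨decode D.M (code D.L D.image), fun _ _ _ => Params.match_le_of_check h⟩

/-- The Thue–Morse word. -/
def thueMorse (p : ℕ) : Fin 2 := Fin.ofNat 2 (Nat.digits 2 p).sum

theorem thueMorse_even (a : ℕ) : thueMorse (2 * a) = thueMorse a := by
  obtain rfl | ha := Nat.eq_zero_or_pos a
  · rfl
  · have := Nat.digits_add 2 (by norm_num) 0 a (by norm_num) (Or.inr (by omega))
    simp only [Nat.zero_add] at this
    simp [thueMorse, this]

theorem thueMorse_odd (a : ℕ) : thueMorse (2 * a + 1) = thueMorse a + 1 := by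
  have := Nat.digits_add 2 (by norm_num) 1 a (by norm_num) (Or.inl (by norm_num))
  rw [Nat.add_comm 1] at this
  apply Fin.ext
  rw [thueMorse, thueMorse, this, List.sum_cons, Nat.add_comm 1]
  simp [Fin.val_add]

theorem thueMorse_succ_ne {b : ℕ} (h : b % 2 = 0) : thueMorse b ≠ thueMorse (b + 1) := by
  obtain ⟨a, rfl⟩ : ∃ a, b = 2 * a := ⟨b / 2, by omega⟩
  rw [thueMorse_even, thueMorse_odd]
  generalize thueMorse a = x
  revert x
  decide

theorem not_match_thueMorse (q : ℕ) (hq : 1 ≤ q) (p : ℕ) : ¬ Match thueMorse p q (q + 1) := by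
  induction q using Nat.strong_induction_on generalizing p with
  | _ q ih =>
  intro hm
  obtain ⟨r, hr⟩ : ∃ r, q = 2 * r ∨ q = 2 * r + 1 := ⟨q / 2, by omega⟩
  obtain ⟨a, ha⟩ : ∃ a, p = 2 * a ∨ p = 2 * a + 1 := ⟨p / 2, by omega⟩
  rcases hr with rfl | rfl
  · refine ih r (by omega) (by omega) a fun k hk => ?_
    have := hm (2 * k) (by omega)
    rcases ha with rfl | rfl
    · rwa [show 2 * a + 2 * k = 2 * (a + k) by ring, thueMorse_even,
        show 2 * a + 2 * r + 2 * k = 2 * (a + r + k) by ring, thueMorse_even] at this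
    · rw [show 2 * a + 1 + 2 * k = 2 * (a + k) + 1 by ring, thueMorse_odd,
        show 2 * a + 1 + 2 * r + 2 * k = 2 * (a + r + k) + 1 by ring, thueMorse_odd] at this
      exact add_right_cancel this
  · have ne : ∀ k < 2 * r + 1, thueMorse (p + k) ≠ thueMorse (p + k + 1) := by
      intro k hk
      by_cases h : (p + k) % 2 = 0
      · exact thueMorse_succ_ne h
      · rw [Nat.add_assoc p, hm k (by omega), hm (k + 1) (by omega), ← Nat.add_assoc]
        exact thueMorse_succ_ne (by omega)
    have alt : ∀ k ≤ r, thueMorse (p + 2 * k) = thueMorse p := by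
      intro k hk
      induction k with
      | zero => rfl
      | succ k ih =>
        have h1 := ne (2 * k) (by omega)
        have h2 := ne (2 * k + 1) (by omega)
        have h3 := ih (by omega)
        rw [← Nat.add_assoc] at h2
        rw [show p + 2 * (k + 1) = p + 2 * k + 1 + 1 by ring]
        omega
    have h1 := ne (2 * r) (by omega)
    rw [alt r le_rfl, Nat.add_assoc] at h1
    exact h1 (hm 0 (by omega))

theorem avoidable_two : Avoidable 2 1 1 := by
  refine ⟨thueMorse, fun p q e hq hm => ?_⟩
  by_contra! h
  exact not_match_thueMorse q hq p fun k hk => hm k (by omega)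

theorem avoidable_3 : Avoidable 3 3 4 :=
  avoidable_of_check ⟨2, 3, 4, 19, 219869, 226781, 17, 2, 8, 129, 4098, [⟨2, 5, 7, 3, 3, 20⟩, ⟨1,
    15, 10, 4, 4, 25⟩], []⟩ (by decide +kernel)

theorem avoidable_4 : Avoidable 4 2 5 :=
  avoidable_of_check ⟨3, 2, 5, 72, 3346745756103090820821, 3346740488696526236373, 65, 2, 10,
    262338, 262338, [⟨2, 2, 8, 4, 3, 109⟩, ⟨1, 6, 12, 5, 4, 168⟩], []⟩ (by decide +kernel)

theorem avoidable_5 : Avoidable 5 1 4 :=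
  avoidable_of_check ⟨4, 1, 4, 40, 471216123227, 373035855285, 30, 19, 1, 17838208, 50860288, [⟨3,
    0, 8, 4, 3, 65⟩, ⟨2, 70, 12, 5, 4, 121⟩, ⟨1, 69, 14, 6, 4, 133⟩], []⟩ (by decide +kernel)

theorem avoidable_6 : Avoidable 6 1 5 :=
  avoidable_of_check ⟨5, 1, 5, 36, 24384466285, 23309505965, 33, 9, 6, 34623555, 2197831749, [⟨3,
    18, 14, 6, 4, 133⟩, ⟨1, 23, 23, 8, 5, 186⟩], []⟩ (by decide +kernel)

theorem avoidable_7 : Avoidable 7 1 6 :=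
  avoidable_of_check ⟨6, 1, 6, 35, 14725527211, 14418619821, 27, 6, 1, 211544989824, 142859571456,
    [⟨3, 0, 8, 4, 3, 61⟩, ⟨2, 9, 28, 8, 5, 153⟩, ⟨1, 9, 28, 8, 5, 193⟩], []⟩ (by decide +kernel)

theorem avoidable_8 : Avoidable 8 1 7 :=
  avoidable_of_check ⟨7, 1, 7, 40, 471026281909, 372409854645, 37, 9, 8, 26736222302272,
    9283656757312, [⟨3, 0, 8, 4, 3, 74⟩, ⟨2, 14, 21, 7, 5, 179⟩, ⟨1, 74, 40, 10, 6, 302⟩], []⟩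
    (by decide +kernel)

theorem avoidable_9 : Avoidable 9 1 8 :=
  avoidable_of_check ⟨8, 1, 8, 45, 12564211391317, 11731348445915, 28, 15, 1, 1724041783414980,
    1992868046848134, [⟨4, 5, 6, 3, 3, 65⟩, ⟨2, 91, 25, 7, 5, 224⟩, ⟨1, 7, 40, 9, 6, 281⟩], []⟩
    (by decide +kernel)

theorem avoidable_10 : Avoidable 10 1 9 :=
  avoidable_of_check ⟨9, 1, 9, 50, 803379460402517, 803583472348013, 37, 10, 3,
    145804385879331399, 20548229583089799, [⟨4, 7, 6, 3, 3, 63⟩, ⟨2, 123, 29, 9, 5, 340⟩, ⟨1, 118,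
    53, 11, 6, 406⟩], []⟩ (by decide +kernel)

theorem avoidable_11 : Avoidable 11 1 10 :=
  avoidable_of_check ⟨10, 1, 10, 55, 12010436705310389, 15388136425838005, 25, 41, 8,
    8163346348754899462, 9259726299081240772, [⟨4, 1, 6, 3, 3, 79⟩, ⟨2, 97, 24, 7, 5, 269⟩, ⟨1,
    89, 33, 8, 6, 341⟩], [⟨1, 94, 78, 12, 7, 501⟩]⟩ (by decide +kernel)

theorem avoidable_12 : Avoidable 12 1 11 :=
  avoidable_of_check ⟨11, 1, 11, 60, 492821681688898923, 492822369202433371, 23, 19, 4,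
    823349223108518638080, 823348374357533286720, [⟨4, 2, 6, 3, 3, 63⟩, ⟨2, 15, 28, 8, 5, 275⟩,
    ⟨1, 15, 28, 8, 5, 364⟩], []⟩ (by decide +kernel)

theorem avoidable_13 : Avoidable 13 1 12 :=
  avoidable_of_check ⟨12, 1, 12, 65, 13090674848494869333, 15468575451749504437, 28, 34, 5,
    42949838859479234388231, 14615803213349690548680, [⟨4, 1, 6, 3, 3, 82⟩, ⟨2, 29, 14, 6, 4,
    294⟩, ⟨1, 83, 55, 9, 6, 469⟩], [⟨1, 78, 62, 11, 6, 541⟩]⟩ (by decide +kernel)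

theorem avoidable_14 : Avoidable 14 1 13 :=
  avoidable_of_check ⟨13, 1, 13, 70, 495384055056692524459, 495372797638172063403, 32, 27, 8,
    61539547486676556730636, 3627153439624779247432333, [⟨4, 6, 6, 3, 3, 102⟩, ⟨2, 24, 14, 6, 4,
    318⟩, ⟨1, 174, 61, 10, 6, 573⟩], []⟩ (by decide +kernel)

theorem avoidable_15 : Avoidable 15 1 14 :=
  avoidable_of_check ⟨14, 1, 14, 75, 16185679631797388498347, 12791496736633340484267, 37, 43, 8,
    195581977642741634964652101, 137227559008022887070466114, [⟨4, 58, 12, 5, 4, 250⟩, ⟨2, 57, 14,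
    6, 4, 296⟩, ⟨1, 35, 63, 12, 6, 701⟩], [⟨1, 83, 125, 13, 7, 785⟩]⟩ (by decide +kernel)

theorem avoidable_16 : Avoidable 16 1 15 :=
  avoidable_of_check ⟨15, 1, 15, 80, 809198038903104491711829, 806836855661669669105077, 46, 64,
    5, 7526508452304569581860344388, 3869214986127822892979220804, [⟨4, 0, 8, 4, 3, 163⟩, ⟨2, 65,
    21, 7, 5, 444⟩, ⟨1, 72, 171, 14, 8, 901⟩], [⟨1, 69, 180, 17, 8, 1171⟩]⟩ (by decide +kernel)

theorem avoidable_17 : Avoidable 17 1 16 :=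
  avoidable_of_check ⟨16, 1, 16, 85, 13805153205105330680978091, 13814597938071069971405675, 28,
    65, 6, 489164708754858827845244027080, 964609515596830288557776322754, [⟨5, 2, 6, 3, 3, 121⟩,
    ⟨2, 16, 12, 5, 4, 261⟩, ⟨1, 129, 55, 10, 6, 689⟩], [⟨1, 74, 181, 18, 8, 1281⟩]⟩
    (by decide +kernel)

theorem avoidable_18 : Avoidable 18 1 17 :=
  avoidable_of_check ⟨17, 1, 17, 90, 419926319967650699968959829, 420001877831376614292379061, 24,
    69, 5, 26160423072856901660235110879367, 10385353185308010944567082488196, [⟨5, 1, 6, 3, 3,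
    122⟩, ⟨2, 4, 12, 5, 4, 330⟩, ⟨1, 242, 49, 10, 6, 681⟩], [⟨1, 77, 199, 19, 8, 1446⟩]⟩
    (by decide +kernel)

theorem avoidable_19 : Avoidable 19 1 18 :=
  avoidable_of_check ⟨18, 1, 18, 95, 16506273425066473119955643757, 16534985413282320562854915499,
    30, 71, 1, 2317603491543208011200679996313992, 2672778332813789641086437117673798, [⟨5, 4, 6,
    3, 3, 155⟩, ⟨2, 0, 12, 5, 4, 349⟩, ⟨1, 17, 53, 11, 6, 847⟩], [⟨1, 85, 209, 19, 8, 1585⟩]⟩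
    (by decide +kernel)

theorem avoidable_20 : Avoidable 20 1 19 :=
  avoidable_of_check ⟨19, 1, 19, 100, 904580356824443283459836130741,
    905354070750949195732500264373, 28, 35, 30, 125919796096969368601703750534967301,
    333682179611751591702158203903554625, [⟨5, 1, 6, 3, 3, 158⟩, ⟨2, 79, 14, 6, 4, 441⟩, ⟨1, 171,
    68, 11, 7, 875⟩], [⟨1, 257, 93, 12, 7, 1008⟩]⟩ (by decide +kernel)

theorem avoidable_21 : Avoidable 21 1 20 :=
  avoidable_of_check ⟨20, 1, 20, 105, 14366733406065858095946724126059,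
    14374238417554025713863300066733, 26, 79, 1, 9492914194852349296976427219818402184,
    9660314746938092331708740611062120774, [⟨5, 1, 6, 3, 3, 160⟩, ⟨2, 15, 12, 5, 4, 327⟩, ⟨1, 254,
    58, 11, 6, 901⟩], [⟨1, 86, 238, 21, 8, 1961⟩]⟩ (by decide +kernel)

theorem avoidable_22 : Avoidable 22 1 21 :=
  avoidable_of_check ⟨21, 1, 21, 110, 432691876459912974849803454961323,
    434593352360255318952048509770411, 32, 88, 10, 953224025967279305024386248482614490256,
    1128556446532895861851765703488741106448, [⟨5, 7, 8, 4, 3, 238⟩, ⟨2, 11, 12, 5, 4, 335⟩, ⟨1,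
    318, 80, 12, 7, 714⟩, ⟨1, 318, 80, 12, 7, 1093⟩], [⟨1, 98, 246, 23, 8, 2269⟩]⟩
    (by decide +kernel)

theorem avoidable_23 : Avoidable 23 1 22 :=
  avoidable_of_check ⟨22, 1, 22, 115, 14090468381192975980412721461638485,
    14090468381948554788808650535906645, 31, 41, 11, 33097839840366160749663563156731957608583,
    93922236782663302197158637448770051904642, [⟨5, 7, 6, 3, 3, 215⟩, ⟨2, 35, 28, 8, 5, 728⟩, ⟨1,
    146, 105, 12, 7, 1145⟩], [⟨1, 120, 133, 14, 8, 1365⟩]⟩ (by decide +kernel)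

theorem avoidable_24 : Avoidable 24 1 23 :=
  avoidable_of_check ⟨23, 1, 23, 120, 450217097189230531464058522296823221,
    450866134296547384917624834338024885, 24, 93, 14, 4983690517215910619426579052170071131845328,
    7394777597109690705984119106797766008714388, [⟨5, 1, 6, 3, 3, 180⟩, ⟨2, 13, 12, 5, 4, 386⟩,
    ⟨1, 250, 70, 11, 7, 722⟩, ⟨1, 250, 70, 11, 7, 1059⟩], [⟨1, 110, 265, 25, 9, 2646⟩]⟩
    (by decide +kernel)

theorem avoidable_25 : Avoidable 25 1 24 :=
  avoidable_of_check ⟨24, 1, 24, 125, 15189200827310518712367255529094559149,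
    15191147938632469272727954465218014637, 25, 97, 11,
    225867295786673776350699864721914666147168969, 359356067307087960852418524922637346828243918,
    [⟨5, 1, 6, 3, 3, 204⟩, ⟨2, 236, 130, 11, 8, 639⟩, ⟨1, 236, 130, 11, 8, 1153⟩], [⟨1, 111, 276,
    26, 9, 2881⟩]⟩ (by decide +kernel)

theorem avoidable_26 : Avoidable 26 1 25 :=
  avoidable_of_check ⟨25, 1, 25, 130, 921709823132121254796670648687507912021,
    964245118997238562729592474616491521365, 31, 101, 22,
    31400164599950813980859140192449487856284792024,
    29978959747396300392798186233528174742785848600, [⟨5, 9, 6, 3, 3, 225⟩, ⟨2, 62, 12, 5, 4,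
    409⟩, ⟨1, 274, 130, 13, 8, 892⟩, ⟨1, 274, 130, 13, 8, 1376⟩], [⟨1, 126, 287, 27, 9, 3126⟩]⟩
    (by decide +kernel)

theorem avoidable_27 : Avoidable 27 1 26 :=
  avoidable_of_check ⟨26, 1, 26, 135, 15543552599101235445096333823947609844443,
    15543220292102289216128107872345748516187, 30, 80, 7,
    376998019104596692641792459119997981277234139334,
    370041939902108506913595518774185581990004416645, [⟨5, 2, 6, 3, 3, 229⟩, ⟨2, 101, 14, 6, 4,
    600⟩, ⟨1, 276, 32, 9, 5, 1015⟩, ⟨1, 277, 138, 13, 8, 1431⟩], [⟨1, 231, 235, 23, 8, 2731⟩]⟩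
    (by decide +kernel)

theorem avoidable_28 : Avoidable 28 1 27 :=
  avoidable_of_check ⟨27, 1, 27, 168, 126915624451199369916547834112158392120098476632939,
    126907060965043134157261484396341695149555058060139, 31, 112, 38,
    77108734475011427539628220881421729759379791020361,
    88809445871096342724385490718304250304144298488642, [⟨5, 2, 6, 3, 3, 238⟩, ⟨2, 0, 8, 4, 3,
    483⟩, ⟨1, 81, 73, 11, 7, 1011⟩, ⟨1, 81, 73, 11, 7, 1540⟩], [⟨1, 295, 273, 25, 9, 3727⟩]⟩
    (by decide +kernel)

theorem avoidable_29 : Avoidable 29 1 28 :=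
  avoidable_of_check ⟨28, 1, 28, 232,
    4602289775896669920898088953412733111633920372717798500976703814063469,
    4602289775896669920898071826440420640115347673286165107035067221104301, 40, 143, 6,
    1896336933623091534546218455724405230255895798387206,
    8378071564936423873891701082910865753556777546106389, [⟨5, 1, 6, 3, 3, 249⟩, ⟨2, 0, 8, 4, 3,
    476⟩, ⟨1, 125, 72, 10, 7, 1176⟩, ⟨1, 125, 72, 10, 7, 1877⟩], [⟨1, 362, 366, 23, 9, 4761⟩]⟩
    (by decide +kernel)

theorem avoidable_30 : Avoidable 30 1 29 :=
  avoidable_of_check ⟨29, 1, 29, 240,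
    737377574590415098943656887846508690147976708482194199271892684915956571,
    737377574590415098943656887846509019796519663141330679416043634441411285, 51, 115, 1,
    34569845034586310502846860797489915451390592455632704,
    34505544673896668646166998829631102628345482255603520, [⟨5, 3, 6, 3, 3, 261⟩, ⟨2, 2, 8, 4, 3,
    545⟩, ⟨1, 29, 25, 8, 5, 1418⟩, ⟨1, 98, 117, 11, 7, 2292⟩], [⟨1, 585, 283, 19, 9, 4148⟩]⟩
    (by decide +kernel)

theorem avoidable_31 : Avoidable 31 1 30 :=
  avoidable_of_check ⟨30, 1, 30, 186, 65390983933608829101796124560476273306761753356615379797,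
    65390981741356373105441747254949024232337223735277611861, 31, 121, 37,
    4695541782471555296818290849722420875526983450353775239,
    37003387926793328343377731257971780303388683665894049433, [⟨5, 5, 6, 3, 3, 253⟩, ⟨2, 23, 12,
    5, 4, 674⟩, ⟨1, 81, 27, 8, 5, 1237⟩, ⟨1, 515, 118, 12, 7, 1801⟩], [⟨1, 319, 304, 27, 9,
    4501⟩]⟩ (by decide +kernel)

theorem avoidable_32 : Avoidable 32 1 31 :=
  avoidable_of_check ⟨31, 1, 31, 192, 2223141338166484616661715739983728830831789915598537206619,
    2223213173894962705201951287500626501574772043994889542491, 27, 159, 12,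
    1486739216365218571164110952871111500040189768425797128909,
    1595861506668835116078874257145091676096136817532139570135, [⟨5, 2, 6, 3, 3, 331⟩, ⟨2, 20, 12,
    5, 4, 739⟩, ⟨1, 32, 26, 8, 5, 1253⟩, ⟨1, 84, 69, 11, 7, 1768⟩], [⟨1, 172, 421, 33, 9, 5860⟩]⟩
    (by decide +kernel)

theorem avoidable_33 : Avoidable 33 1 32 :=
  avoidable_of_check ⟨32, 1, 32, 264,
    10057110244400396844708962772139925239168542795756360428508175558265304142162603,
    10057336400824688477903149434220020332738568713695160507734815123524818062629547, 31, 198, 12,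
    57297284971240500372992685649738031797861740618851686871691,
    133129951102248108216550501312292362225081877257815746733324, [⟨6, 8, 6, 3, 3, 267⟩, ⟨2, 7, 8,
    4, 3, 576⟩, ⟨1, 17, 14, 6, 4, 1280⟩, ⟨1, 772, 33, 9, 6, 1985⟩], [⟨1, 247, 559, 30, 10, 7329⟩]⟩
    (by decide +kernel)

theorem avoidable_34 : Avoidable 34 1 33 :=
  avoidable_of_check ⟨33, 1, 33, 238,
    156764371982819350758317533914123144379444665338224732032840587210831275,
    149862625636028786970882778051814812949237622309040857657170275751081387, 44, 97, 97,
    13263913006738161273924615846583588452191016404790778044983232,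
    13345236582737582752482057195257389284952542663731617424013312, [⟨6, 4, 6, 3, 3, 294⟩, ⟨2, 12,
    12, 5, 4, 737⟩, ⟨1, 122, 31, 9, 5, 1623⟩, ⟨1, 115, 80, 12, 7, 2509⟩], [⟨1, 318, 406, 20, 9,
    4258⟩]⟩ (by decide +kernel)

theorem avoidable_35 : Avoidable 35 1 34 :=
  avoidable_of_check ⟨34, 1, 34, 245,
    20061373889283654540868268655184367471623544032872916582082218348021995227,
    20061373889283641986664797881822839800044697617540084377317286224424523483, 50, 137, 54,
    524008067256269103079485435106976370034932019520646727469175766,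
    313825782755984376438830922141281063179784775309418333841490583, [⟨6, 8, 6, 3, 3, 316⟩, ⟨2,
    63, 12, 5, 4, 731⟩, ⟨1, 522, 33, 9, 6, 1777⟩, ⟨1, 23, 153, 13, 8, 2823⟩], [⟨1, 433, 384, 26,
    9, 5781⟩]⟩ (by decide +kernel)

theorem avoidable_36 : Avoidable 36 1 35 :=
  avoidable_of_check ⟨35, 1, 35, 288,
    177476671008575747029292847670553637673128566111537516533838545958481200582393565915995,
    177476671008575747029371831889305055563152004632300269358077717279441316605475593497435, 34,
    144, 69, 56847059675143317589441105701881611277595883483141590274923943905,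
    56847134534418192930050442278400111443246454016165612307525679009, [⟨6, 2, 6, 3, 3, 292⟩, ⟨2,
    1, 8, 4, 3, 681⟩, ⟨1, 173, 19, 7, 5, 1531⟩, ⟨1, 125, 49, 10, 6, 2381⟩], [⟨1, 479, 479, 24, 9,
    6231⟩]⟩ (by decide +kernel)

theorem avoidable_37 : Avoidable 37 1 36 :=
  avoidable_of_check ⟨36, 1, 36, 296,
    53421169984641208916490309679664494730510162618643735301368285054643529876004636686921131,
    53421169984641209344398583183052194007432833446060755654246061986810491226676895075904939, 40,
    68, 81, 1715163861472316732753060955363097956892021241706479300908417319631,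
    2147933920607353905505284311230993312604508709643897090224872293907, [⟨6, 4, 6, 3, 3, 372⟩,
    ⟨2, 3, 8, 4, 3, 786⟩, ⟨1, 110, 25, 8, 5, 1743⟩, ⟨1, 790, 83, 11, 7, 2701⟩], [⟨1, 493, 258, 14,
    9, 3709⟩]⟩ (by decide +kernel)

theorem avoidable_38 : Avoidable 38 1 37 :=
  avoidable_of_check ⟨37, 1, 37, 304,
    13963556907775528668614748136613360595502334238573713335897870749082030436045822842063140525,
    13963556907775530477866142469678914088798974999322273543241381149715843551201478678982538925,
    37, 189, 19, 122934523591795302584534251455969992936970710490432295144195849233232,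
    35617257131068218946028495575660226666036100585180238228541146490131, [⟨6, 1, 6, 3, 3, 325⟩,
    ⟨2, 0, 8, 4, 3, 811⟩, ⟨1, 197, 19, 7, 5, 1756⟩, ⟨1, 269, 76, 11, 7, 2702⟩], [⟨1, 525, 478, 30,
    9, 8326⟩]⟩ (by decide +kernel)

theorem avoidable_39 : Avoidable 39 1 38 :=
  avoidable_of_check ⟨38, 1, 38, 312,
    2783973371461367233026357705392417584686464172630328614956004369460634576673283654602196441965,
    2783973371461367233026357705392417584686464172630334190142304002116419961027126930387557079917,
    51, 73, 26, 13563735076849254543836681894993345770333956186390160161212096750708829,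
    1018063925572910480449258852771377240023891229991751274609339461379606, [⟨6, 19, 6, 3, 3,
    392⟩, ⟨2, 18, 8, 4, 3, 894⟩, ⟨1, 48, 26, 8, 5, 2119⟩, ⟨1, 144, 172, 13, 8, 3345⟩], [⟨1, 674,
    415, 15, 9, 4181⟩]⟩ (by decide +kernel)

theorem avoidable_40 : Avoidable 40 1 39 :=
  avoidable_of_check ⟨39, 1, 39, 320,
    724556053458846195286479538213921716850497305904616111824530915391972502622013781580246767326939,
    724556053458846269393416650096286787935863346652160744103135127571678194315490110831588737242843,
    34, 77, 140, 532400103718506364420511758028009691681790149187238268964331059409946069,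
    446936108369019896832118154139029024412652828322953170822336390061150857, [⟨6, 8, 6, 3, 3,
    362⟩, ⟨2, 7, 8, 4, 3, 758⟩, ⟨1, 227, 21, 7, 5, 1783⟩, ⟨1, 176, 111, 11, 7, 2809⟩], [⟨1, 815,
    420, 16, 9, 4486⟩]⟩ (by decide +kernel)

theorem avoidable_41 : Avoidable 41 1 40 :=
  avoidable_of_check ⟨40, 1, 40, 328,
    388039046727013370977248113517896862205294724798728763729779019657377425034001133750843962377481645,
    388039046727013370977248113538602101245666416161033031316610096013432677735878586509198910966574509,
    36, 121, 110, 51966870513209441555263665343080283617500017421715061228530568170073343383,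
    16788724000344077296484402391439913460457287998049990741216040809987175051, [⟨6, 1, 6, 3, 3,
    379⟩, ⟨2, 114, 12, 5, 4, 978⟩, ⟨1, 309, 26, 8, 5, 1989⟩, ⟨1, 218, 109, 11, 7, 3001⟩], [⟨1,
    745, 487, 22, 9, 6401⟩]⟩ (by decide +kernel)

theorem avoidable_42 : Avoidable 42 1 41 :=
  avoidable_of_check ⟨41, 1, 41, 336,
    99207364907491139429953639240993760075745672551210975891608061570411225267053126872830346014971751861,
    99207364907491139429952481320101386913791436841360889012529528870564568861412732296991955733535616437,
    35, 206, 49, 1030211167939070566709350598403158723880007801108126938076941459359026168326,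
    3863226282132717529288187486053225493014994700451593870401590375846543759653, [⟨6, 1, 6, 3, 3,
    360⟩, ⟨2, 0, 8, 4, 3, 803⟩, ⟨1, 85, 84, 11, 7, 1939⟩, ⟨1, 85, 84, 11, 7, 3076⟩], [⟨1, 562,
    529, 32, 10, 10087⟩]⟩ (by decide +kernel)

theorem avoidable_43 : Avoidable 43 1 42 :=
  avoidable_of_check ⟨42, 1, 42, 344,
    24264636887558741731378757375190618971197464288796184672259678928962582868417116958168993674118210966893,
    24264636887558741731378757375190618971197400011274414312648657250482378445401950605300182007923315496301,
    43, 81, 75, 279262547664004075016103681991580900031125987521000735704615989331763395688356,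
    272353281857354583198320524714089198967408150312645712303392768780625744652519, [⟨6, 4, 6, 3,
    3, 476⟩, ⟨2, 3, 8, 4, 3, 914⟩, ⟨1, 260, 25, 8, 5, 2221⟩, ⟨1, 794, 230, 12, 8, 3529⟩], [⟨1,
    454, 373, 17, 9, 5125⟩]⟩ (by decide +kernel)

theorem avoidable_44 : Avoidable 44 1 43 :=
  avoidable_of_check ⟨43, 1, 43, 352,
    6552210751679255219503185740979461043085781624430656691044752453963519530963097204915088115647851280053933,
    6552210751679254582929443136452559084196512635398907297716935541871105085461445904155042213432646826309293,
    39, 83, 165, 18338649267760701022091243603251906522261336453527238527763339934976697675409572,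
    18809895694364335117585984860771444268210321391972051073166000880984053184356969, [⟨6, 1, 6,
    3, 3, 425⟩, ⟨2, 0, 8, 4, 3, 800⟩, ⟨1, 316, 138, 12, 8, 2142⟩, ⟨1, 316, 138, 12, 8, 3484⟩],
    [⟨1, 903, 469, 17, 9, 5376⟩]⟩ (by decide +kernel)

theorem avoidable_45 : Avoidable 45 1 44 :=
  avoidable_of_check ⟨44, 1, 44, 360,
    796801185500218304892789603453774071764547269858161885343324925467169689241172875594995008036762255535856309,
    796801185500218304892789603453774071764547269858161885343321454400781028128665673785054546466309727036594869,
    38, 85, 25, 574527044421600167126124449869076876143571484975196253711786472357130902951253140,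
    393948119847395319162462614786161514117640013687522594717004981202646061617386513, [⟨6, 1, 6,
    3, 3, 489⟩, ⟨2, 41, 12, 5, 4, 1265⟩, ⟨1, 48, 25, 8, 5, 2415⟩, ⟨1, 9, 100, 12, 7, 3565⟩], [⟨1,
    731, 483, 18, 9, 5633⟩]⟩ (by decide +kernel)

theorem avoidable_46 : Avoidable 46 1 45 :=
  avoidable_of_check ⟨45, 1, 45, 368,
    201198123398616733985584322889372998976542365397810702111376200515165944246904103549579053769394492901157460827,
    201198123398616733985584322889372998976542365429075288700479115316110358715493763144251035216432510305821219675,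
    41, 179, 25,
    52007108696057084013337986549381317787301474372609815584494661082347088584306685465,
    61732537050283697258865996168009230137673264018144523713829851574380471193927534555, [⟨6, 2,
    6, 3, 3, 462⟩, ⟨2, 1, 8, 4, 3, 880⟩, ⟨1, 150, 30, 8, 5, 2353⟩, ⟨1, 951, 113, 12, 7, 3826⟩],
    [⟨1, 550, 614, 29, 10, 10036⟩]⟩ (by decide +kernel)

theorem avoidable_47 : Avoidable 47 1 46 :=
  avoidable_of_check ⟨46, 1, 46, 376,
    103013731887454690906177245947293066477593122963347912103566876608703071681345334134301311292323120138491616647861,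
    103013731887454690906177245947293066477593122693748445432060478662032920868316465040646639159361093008919989934773,
    33, 89, 85,
    5423353958208143792421478044698019594108253074453924238812414952344338200300180892137,
    5184362779317374697985090056433909064206352763491050760662209354310192787524637592286, [⟨6, 1,
    6, 3, 3, 472⟩, ⟨2, 0, 8, 4, 3, 895⟩, ⟨1, 133, 26, 8, 5, 2242⟩, ⟨1, 97, 79, 11, 7, 3589⟩], [⟨1,
    453, 542, 18, 10, 6165⟩]⟩ (by decide +kernel)

theorem avoidable_48 : Avoidable 48 1 47 :=
  avoidable_of_check ⟨47, 1, 47, 480,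
    1333500966804273456103344950260586676994528253010211146157367852535459801563802192328808085337417980932532404186575159388175515156053799434106285,
    1333500966804273456103345313389475782966048673373844709080912680150336918173358684238303319565788233858885086613263883161412443450687721055106477,
    44, 187, 200,
    62739634475299974973665588941451102318059272129112905738212335925406572246887913750981,
    52096071055219206307642570267378776537827800454950118074211651807893410194675620671810, [⟨6,
    0, 4, 2, 2, 466⟩, ⟨2, 0, 8, 4, 3, 1085⟩, ⟨1, 90, 19, 7, 5, 2658⟩, ⟨1, 75, 77, 11, 7, 4231⟩],
    [⟨1, 658, 725, 25, 10, 10952⟩]⟩ (by decide +kernel)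

theorem avoidable_49 : Avoidable 49 1 48 :=
  avoidable_of_check ⟨48, 1, 48, 490,
    1366416406999355669684577409697504496249738861421921483353925510028868753803295074980150054192344557603274904841357811630532421997279531397202794165,
    1366416406999355669684577409697504496249738861421921483354562083771473280705253964257775875761490051549864004459347080386283141173304958727834261173,
    34, 95, 146,
    23211266203539999716633561481487673702113383488871443467493263739238959524724231888191536,
    332256103101591673174104337724389850179164117922612187686695739435110345531663823333953, [⟨6,
    1, 6, 3, 3, 496⟩, ⟨2, 0, 8, 4, 3, 1028⟩, ⟨1, 1164, 19, 7, 5, 2458⟩, ⟨1, 237, 63, 10, 6,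
    3889⟩], [⟨1, 623, 565, 16, 10, 6817⟩]⟩ (by decide +kernel)

theorem avoidable_50 : Avoidable 50 1 49 :=
  avoidable_of_check ⟨49, 1, 49, 500,
    2191089231504895571790285969537909497550869253298658073067822747868727051830715674174954009539213834920403852431727787670826658854148629222699110853485,
    2191089231504895571790285969537909497550869253298658073067822747868727051830715674174680855782698514284801642897476003698708814216738052424443416636269,
    45, 94, 63,
    322296917448260525989910050713501345641177875858226821643509693663674523889509150175028043,
    291766914329944887282213415985426568161960232710529419318919193563303157826698834741850668,
    [⟨6, 7, 6, 3, 3, 497⟩, ⟨2, 6, 8, 4, 3, 1141⟩, ⟨1, 205, 89, 11, 7, 2849⟩, ⟨1, 205, 89, 11, 7,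
    4558⟩], [⟨1, 92, 377, 16, 9, 6959⟩]⟩ (by decide +kernel)

theorem avoidable_51 : Avoidable 51 1 50 :=
  avoidable_of_check ⟨50, 1, 50, 408,
    472124716890984207030674197622094900980943870789293703873427155039457723154167161006835009503805983473975630653272509560173,
    472124716890984207030674197622094912924472220193076031886278958190451961191684407499388786159948756524474541238476124894573,
    37, 195, 79,
    76600527620889385341341789001073379264804830227180981866371220443976188374493870904268159075,
    42150283317306110334231987854170307785041116877116257054408876844907503492774669157211923819,
    [⟨6, 4, 6, 3, 3, 473⟩, ⟨2, 3, 8, 4, 3, 1111⟩, ⟨1, 206, 25, 8, 5, 2706⟩, ⟨1, 818, 137, 12, 8,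
    4301⟩], [⟨1, 659, 684, 32, 10, 12201⟩]⟩ (by decide +kernel)

theorem avoidable_52 : Avoidable 52 1 51 :=
  avoidable_of_check ⟨51, 1, 51, 520,
    1470529542829695293779035912794758363069093323645768080195485516304295689533597604795579973063826981542449678922471557059762834161524724962617991424296539483,
    1470529542829695293779035912794758363069093323645768075890976089931328222368513221828064891880468891102347270288235771132470954227277569140944955695863092571,
    41, 99, 179,
    3844924122552878039563566186162840182370309642316859074918733095936790845123759944048652928667,
    3044118177471856511485906706242726184017787192608890271358711722955431678757452337674027621035,
    [⟨6, 2, 6, 3, 3, 518⟩, ⟨2, 1, 8, 4, 3, 1305⟩, ⟨1, 328, 19, 7, 5, 2973⟩, ⟨1, 1266, 80, 11, 7,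
    4642⟩], [⟨1, 854, 447, 16, 9, 7600⟩]⟩ (by decide +kernel)

theorem avoidable_53 : Avoidable 53 1 52 :=
  avoidable_of_check ⟨52, 1, 52, 424,
    18178660427091931167404425779675297071885757329761036771191452419267136565710289762406894729964230752186719453070218059479440219,
    18178660427091931167404425779675297071885757329761036771191452420964063140447783493379206699476475008914061592259459453106707291,
    42, 100, 44,
    381300065166118721071476135591286679573027853971045757876373902358450576406738915386815577762411,
    381676939689747441773842233525983760748745899943656528001063265603243557975905511076482018355952,
    [⟨6, 2, 6, 3, 3, 506⟩, ⟨2, 1, 8, 4, 3, 1070⟩, ⟨1, 266, 33, 9, 6, 2953⟩, ⟨1, 104, 158, 13, 8,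
    4837⟩], [⟨1, 873, 612, 20, 10, 7853⟩]⟩ (by decide +kernel)

theorem avoidable_54 : Avoidable 54 1 53 :=
  avoidable_of_check ⟨53, 1, 53, 540,
    1537129206688031978636973719373175527791087190542563986647728244723314483064139209672594353393521438323083169229084023026851988540487367092102050708875005318229421,
    1537129206696215455156714075093039168208091093587758565601842424830382167472243842306870142777225033264361562890829482591081843049906390049695282628147899798482349,
    40, 157, 284,
    5441950406618514010972030936923301520807759125591545897890404603401548388641487249578721010282629,
    3808137706333035264160673719609592777427413316681034973254563749011914522768570307134967138752198,
    [⟨6, 0, 4, 2, 2, 449⟩, ⟨2, 0, 8, 4, 3, 1063⟩, ⟨1, 177, 21, 7, 5, 2970⟩, ⟨1, 313, 70, 11, 7,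
    4877⟩], [⟨1, 1343, 786, 22, 10, 11078⟩]⟩ (by decide +kernel)

theorem avoidable_55 : Avoidable 55 1 54 :=
  avoidable_of_check ⟨54, 1, 54, 660,
    1601721607016322874347876456753180717329747434338098064131531683609031797685464104969645502048332505149673409172643688078385919165179874144106084046582152550973028591190986853911849579249026997791595,
    1601721607016322874347876456753180717329747434338098064131531683609031797685464104969645502048480328302657144250540479268903436487535902746923570915885551831636612270128961777991226518118528739289963,
    42, 216, 66,
    589718758615068225925510273843801668824070802145456939236829042700247700368199722976504089393841619,
    928183160043213839334574934084834069822074562845981443919518544922189864053679463797355260386806234,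
    [⟨6, 0, 4, 2, 2, 442⟩, ⟨2, 2, 6, 3, 3, 1152⟩, ⟨1, 4, 14, 6, 4, 3141⟩, ⟨1, 121, 31, 9, 5,
    5131⟩], [⟨1, 1363, 973, 24, 10, 14527⟩]⟩ (by decide +kernel)

theorem avoidable_56 : Avoidable 56 1 55 :=
  avoidable_of_check ⟨55, 1, 55, 560,
    1278344502334635667415800782812634753926669336017321441850788736550853712501302247588720398576974025470812246138005379469004949860081659613402982914769702415761503251291,
    1278344502334635667415800782812634753926669336017321441850788736550853712501302247588720399126986449348064191272817022979670405353716056357399893735226447721986391894875,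
    43, 107, 89,
    62178227141204779510772130190147643539076243124548879076859623964754846566161754851461549880745281502,
    35449476159282870331193935237438257428212155586004319323068482770304963815914273258833578909905250767,
    [⟨6, 2, 6, 3, 3, 593⟩, ⟨2, 1, 8, 4, 3, 1128⟩, ⟨1, 1157, 71, 11, 7, 3232⟩, ⟨1, 1157, 71, 11, 7,
    5336⟩], [⟨1, 1320, 634, 18, 10, 8856⟩]⟩ (by decide +kernel)

namespace Large

/-- The number of letters rotating through the even columns. -/
def ring (M : ℕ) : ℕ := (M + 1) / 2 + 1

/-- The slot occupied by column `c` in row `a` of a block. -/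
def slot (M a c : ℕ) : ℕ :=
  if c % 2 = 1 then c + 1 else if 2 * a ≤ c then c + 1 - 2 * a else c + 1 + 2 * ring M - 2 * a

/-- The cyclic permutation applied to an active class of four letters. -/
def turn (r : ℕ) : ℕ := if r = 0 then 1 else if r = 1 then 3 else if r = 3 then 2 else 0

/-- The number of classes that encode the binary valuation of the block index. -/
def letters (M : ℕ) : ℕ := M / 4 - 6

/-- The class encoding the valuation `t`. -/
def letter (M t : ℕ) : ℕ := if t + 3 < M / 8 then t + 3 else t + 6

/-- The class `y` is permuted on entering the block `x`. -/
def Active (M y x : ℕ) : Prop :=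
  y = 1 ∨ y = M / 8 + 1 ∨ y = letter M (padicValNat 2 x % letters M)

instance (M y x : ℕ) : Decidable (Active M y x) := by unfold Active; infer_instance

/-- How often the class `y` has been permuted up to the block `i`. -/
def turns (M y i : ℕ) : ℕ := ((Finset.Ioc 0 i).filter (Active M y)).card

/-- The letter in row `R` and column `c`, as a positive number. -/
def value (M R c : ℕ) : ℕ :=
  4 * (slot M (R % ring M) c / 4) +
    turn^[turns M (slot M (R % ring M) c / 4) (R / ring M)] (slot M (R % ring M) c % 4)

theorem turn_lt {r : ℕ} : turn r < 4 := by unfold turn; split_ifs <;> omega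

theorem iterate_turn_lt (k : ℕ) {r : ℕ} (h : r < 4) : turn^[k] r < 4 := by
  induction k with
  | zero => exact h
  | succ k ih => rw [Function.iterate_succ_apply']; exact turn_lt

theorem turn_inj {r r' : ℕ} (h : r < 4) (h' : r' < 4) (e : turn r = turn r') : r = r' := by
  interval_cases r <;> interval_cases r' <;> simp_all [turn]

theorem iterate_turn_inj (k : ℕ) {r r' : ℕ} (h : r < 4) (h' : r' < 4)
    (e : turn^[k] r = turn^[k] r') : r = r' := by
  induction k with
  | zero => exact e
  | succ k ih =>
    rw [Function.iterate_succ_apply', Function.iterate_succ_apply'] at e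
    exact ih (turn_inj (iterate_turn_lt k h) (iterate_turn_lt k h') e)

theorem iterate_turn_mod (k : ℕ) {r : ℕ} (h : r < 4) : turn^[k] r = turn^[k % 4] r := by
  have h4 : ∀ r < 4, turn^[4] r = r := by decide
  have : ∀ j r, r < 4 → turn^[4 * j] r = r := by
    intro j
    induction j with
    | zero => intro r _; rfl
    | succ j ih =>
      intro r hr
      rw [Nat.mul_succ, Function.iterate_add_apply, h4 r hr, ih r hr]
  conv_lhs => rw [← Nat.mod_add_div k 4, Function.iterate_add_apply, this _ _ h]

theorem active_bounds {M y x : ℕ} (hM : 56 ≤ M) (h : Active M y x) : 1 ≤ y ∧ y + 1 ≤ M / 4 := by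
  have hm : padicValNat 2 x % letters M < letters M :=
    Nat.mod_lt _ (by unfold letters; omega)
  unfold Active letter at h
  generalize padicValNat 2 x % letters M = t at *
  unfold letters at hm
  split_ifs at h <;> omega

theorem active_gap {M y y' x : ℕ} (hM : 56 ≤ M) (h : Active M y x) (h' : Active M y' x) :
    y' ≠ y + 1 := by
  unfold Active letter at h h'
  split_ifs at h h' <;> omega

theorem turns_succ (M y i : ℕ) :
    turns M y (i + 1) = turns M y i + if Active M y (i + 1) then 1 else 0 := by
  have : Finset.Ioc 0 (i + 1) = insert (i + 1) (Finset.Ioc 0 i) := by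
    ext t; simp only [Finset.mem_Ioc, Finset.mem_insert]; omega
  unfold turns
  rw [this, Finset.filter_insert]
  split_ifs with h
  · rw [Finset.card_insert_of_notMem (by simp)]
  · rfl

theorem turns_mono (M y : ℕ) : Monotone (turns M y) :=
  monotone_nat_of_le_succ fun i => by rw [turns_succ]; exact Nat.le_add_right _ _

theorem turns_eq_zero {M y : ℕ} (hM : 56 ≤ M) (h : y = 0 ∨ M / 4 ≤ y) (i : ℕ) :
    turns M y i = 0 := by
  unfold turns
  rw [Finset.card_eq_zero, Finset.filter_eq_empty_iff]
  intro x _ hx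
  have := active_bounds hM hx
  omega

theorem slot_spec {M a c : ℕ} (ha : a < ring M) (hc : c < M) :
    1 ≤ slot M a c ∧ slot M a c < 2 * ring M ∧ (c + slot M a c) % 2 = 1 ∧
      (slot M a c % 2 = 0 → slot M a c ≤ M) := by
  unfold slot ring at *
  split_ifs <;> omega

theorem value_bounds {M R c : ℕ} (hM : 56 ≤ M) (hc : c < M) :
    1 ≤ value M R c ∧ (value M R c ≤ M ∨ value M R c = 2 * ring M - 1) := by
  have ha : R % ring M < ring M := Nat.mod_lt _ (by unfold ring; omega)
  obtain ⟨h1, h2, h3, h4⟩ := slot_spec ha hc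
  unfold value
  generalize slot M (R % ring M) c = s at *
  have h5 := iterate_turn_lt (turns M (s / 4) (R / ring M)) (Nat.mod_lt s (by norm_num : 4 > 0))
  by_cases h : s / 4 = 0 ∨ M / 4 ≤ s / 4
  · rw [turns_eq_zero hM h]
    simp only [Function.iterate_zero, id]
    unfold ring at *
    omega
  · omega

theorem eq_of_value_eq {M R c R' c' : ℕ} (hR : R ≤ R') (h : value M R c = value M R' c') :
    slot M (R % ring M) c / 4 = slot M (R' % ring M) c' / 4 ∧
      slot M (R % ring M) c % 4 =
        turn^[(turns M (slot M (R % ring M) c / 4) (R' / ring M) -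
          turns M (slot M (R % ring M) c / 4) (R / ring M)) % 4] (slot M (R' % ring M) c' % 4) := by
  unfold value at h
  have hi : R / ring M ≤ R' / ring M := Nat.div_le_div_right hR
  generalize slot M (R % ring M) c = s at *
  generalize slot M (R' % ring M) c' = s' at *
  have h5 := iterate_turn_lt (turns M (s / 4) (R / ring M)) (Nat.mod_lt s (by norm_num : 4 > 0))
  have h6 := iterate_turn_lt (turns M (s' / 4) (R' / ring M))
    (Nat.mod_lt s' (by norm_num : 4 > 0))
  have h7 : s / 4 = s' / 4 := by omega
  refine ⟨h7, ?_⟩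
  have h8 : turn^[turns M (s / 4) (R / ring M)] (s % 4) =
      turn^[turns M (s' / 4) (R' / ring M)] (s' % 4) := by omega
  rw [← iterate_turn_mod _ (Nat.mod_lt s' (by norm_num : 4 > 0))]
  rw [← h7, ← Nat.add_sub_cancel' (turns_mono M (s / 4) hi), Function.iterate_add_apply] at h8
  exact iterate_turn_inj _ (Nat.mod_lt _ (by norm_num))
    (iterate_turn_lt _ (Nat.mod_lt _ (by norm_num))) h8

/-- Equal letters at a distance of fewer than `ring M` rows. -/
theorem near {M R c D c' : ℕ} (hD : D < ring M) (h : value M R c = value M (R + D) c') :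
    ∃ a a' s s', a = R % ring M ∧ a' = (R + D) % ring M ∧ a < ring M ∧ a' < ring M ∧
      s = slot M a c ∧ s' = slot M a' c' ∧
      ((a' = a + D ∧ s = s') ∨
      (a' + ring M = a + D ∧ s = s' ∧ ¬ Active M (s / 4) ((R + D) / ring M)) ∨
      (a' + ring M = a + D ∧ Active M (s / 4) ((R + D) / ring M) ∧ s / 4 = s' / 4 ∧
        (s % 4 = 0 ∧ s' % 4 = 2 ∨ s % 4 = 2 ∧ s' % 4 = 3 ∨ s % 4 = 3 ∧ s' % 4 = 1 ∨
          s % 4 = 1 ∧ s' % 4 = 0))) := by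
  obtain ⟨h1, h2⟩ := eq_of_value_eq (Nat.le_add_right R D) h
  have hr : 0 < ring M := by unfold ring; omega
  have ha := Nat.mod_lt R hr
  have ha' := Nat.mod_lt (R + D) hr
  refine ⟨_, _, _, _, rfl, rfl, ha, ha', rfl, rfl, ?_⟩
  generalize slot M (R % ring M) c = s at *
  generalize slot M ((R + D) % ring M) c' = s' at *
  have e1 := Nat.div_add_mod R (ring M)
  have e2 := Nat.div_add_mod (R + D) (ring M)
  generalize R % ring M = a at *
  generalize (R + D) % ring M = a' at *
  have e3 : R / ring M ≤ (R + D) / ring M := Nat.div_le_div_right (Nat.le_add_right R D)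
  have e4 : (R + D) / ring M ≤ R / ring M + 1 := by
    rw [← Nat.add_div_right _ hr]
    exact Nat.div_le_div_right (by omega)
  generalize R / ring M = i at *
  generalize (R + D) / ring M = i' at *
  have h3 : i' = i ∨ i' = i + 1 := by omega
  have hs' : s' % 4 < 4 := Nat.mod_lt _ (by norm_num)
  rcases h3 with rfl | rfl
  · left
    rw [Nat.sub_self] at h2
    simp only [Nat.zero_mod, Function.iterate_zero, id] at h2
    omega
  · right
    rw [turns_succ, Nat.add_sub_cancel_left] at h2
    rw [Nat.mul_succ] at e2
    split_ifs at h2 with hA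
    · right
      refine ⟨by omega, hA, h1, ?_⟩
      simp only [Nat.one_mod, Function.iterate_one] at h2
      unfold turn at h2
      split_ifs at h2 <;> omega
    · left
      simp only [Nat.zero_mod, Function.iterate_zero, id] at h2
      exact ⟨by omega, by omega, hA⟩

theorem slot_odd {M a c : ℕ} (h : c % 2 = 1) : slot M a c = c + 1 := by
  unfold slot; rw [if_pos h]

theorem slot_even {M a c : ℕ} (ha : a < ring M) (h : c % 2 = 0) :
    2 * a ≤ c ∧ slot M a c + 2 * a = c + 1 ∨
      c < 2 * a ∧ slot M a c + 2 * a = c + 1 + 2 * ring M := by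
  unfold slot; split_ifs <;> omega

theorem slot_parity {M a c : ℕ} (ha : a < ring M) : (c + slot M a c) % 2 = 1 := by
  unfold slot; split_ifs <;> omega

theorem pair_even {M R c D c' : ℕ} (hM : 56 ≤ M) (hD : 1 ≤ D) (hD' : D ≤ 15) (h0 : c % 2 = 0) (h : value M R c = value M (R + D) c')
    (h1 : value M R (c + 1) = value M (R + D) (c' + 1)) :
    4 ≤ slot M (R % ring M) c ∧ 4 ≤ slot M (R % ring M) (c + 1) ∧
      slot M (R % ring M) c % 4 + slot M (R % ring M) (c + 1) % 4 = 3 ∧ (3 ≤ D ∨ D = 2 ∧ c ≤ c') := by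
  have hrM : 2 * ring M = M + 2 ∨ 2 * ring M = M + 3 := by unfold ring; omega
  have hr : D < ring M := by omega
  obtain ⟨a, a', s, s', ha, ha', hal, hal', hs, hs', H⟩ := near hr h
  obtain ⟨b, b', t, t', hb, hb', -, -, ht, ht', H1⟩ := near hr h1
  obtain rfl : a = b := by omega
  obtain rfl : a' = b' := by omega
  rw [← ha, ← hs, ← ht]
  clear ha ha' hb hb' h h1
  have p := @slot_parity M a' c' hal'
  have p1 := @slot_parity M a' (c' + 1) hal'
  have e := @slot_even M a c hal h0
  have e1 := @slot_odd M a (c + 1) (by omega)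
  rw [← hs] at e
  rw [← ht] at e1
  rw [← hs'] at p
  rw [← ht'] at p1
  rcases H with ⟨ha, H⟩ | ⟨ha, H, hA⟩ | ⟨ha, hA, hq, H⟩ <;>
  rcases H1 with ⟨ha1, H1⟩ | ⟨ha1, H1, hA1⟩ | ⟨ha1, hA1, hq1, H1⟩
  · have o := @slot_even M a' c' hal' (by omega)
    have o1 := @slot_odd M a' (c' + 1) (by omega)
    rw [← hs'] at o
    rw [← ht'] at o1
    omega
  · omega
  · omega
  · omega
  · have o := @slot_even M a' c' hal' (by omega)
    have o1 := @slot_odd M a' (c' + 1) (by omega)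
    rw [← hs'] at o
    rw [← ht'] at o1
    omega
  · have : s / 4 ≠ t / 4 := fun h => hA (h ▸ hA1)
    have o := @slot_even M a' c' hal' (by omega)
    have o1 := @slot_odd M a' (c' + 1) (by omega)
    rw [← hs'] at o
    rw [← ht'] at o1
    omega
  · omega
  · have : s / 4 ≠ t / 4 := fun h => hA1 (h ▸ hA)
    have o := @slot_even M a' c' hal' (by omega)
    have o1 := @slot_odd M a' (c' + 1) (by omega)
    rw [← hs'] at o
    rw [← ht'] at o1
    omega
  · have := active_bounds hM hA
    have := active_bounds hM hA1
    have := active_gap hM hA hA1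
    have := active_gap hM hA1 hA
    have o := @slot_parity M a' c' hal'
    refine ⟨by omega, by omega, by omega, ?_⟩
    by_contra
    rcases Nat.mod_two_eq_zero_or_one c' with q | q
    · have q0 := @slot_even M a' c' hal' q
      have q1 := @slot_odd M a' (c' + 1) (by omega)
      rw [← hs'] at q0
      rw [← ht'] at q1
      clear hs hs' ht ht'
      omega
    · have q0 := @slot_odd M a' c' q
      have q1 := @slot_even M a' (c' + 1) hal' (by omega)
      rw [← hs'] at q0
      rw [← ht'] at q1
      clear hs hs' ht ht'
      omega

theorem pair_odd {M R c D c' : ℕ} (hM : 56 ≤ M) (hD : 1 ≤ D) (hD' : D ≤ 15) (h0 : c % 2 = 1) (h : value M R c = value M (R + D) c')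
    (h1 : value M R (c + 1) = value M (R + D) (c' + 1)) :
    4 ≤ slot M (R % ring M) c ∧ 4 ≤ slot M (R % ring M) (c + 1) ∧
      slot M (R % ring M) c % 4 + slot M (R % ring M) (c + 1) % 4 = 3 ∧ (3 ≤ D ∨ D = 2 ∧ c ≤ c') := by
  have hrM : 2 * ring M = M + 2 ∨ 2 * ring M = M + 3 := by unfold ring; omega
  have hr : D < ring M := by omega
  obtain ⟨a, a', s, s', ha, ha', hal, hal', hs, hs', H⟩ := near hr h
  obtain ⟨b, b', t, t', hb, hb', -, -, ht, ht', H1⟩ := near hr h1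
  obtain rfl : a = b := by omega
  obtain rfl : a' = b' := by omega
  rw [← ha, ← hs, ← ht]
  clear ha ha' hb hb' h h1
  have p := @slot_parity M a' c' hal'
  have p1 := @slot_parity M a' (c' + 1) hal'
  have e := @slot_odd M a c h0
  have e1 := @slot_even M a (c + 1) hal (by omega)
  rw [← hs] at e
  rw [← ht] at e1
  rw [← hs'] at p
  rw [← ht'] at p1
  rcases H with ⟨ha, H⟩ | ⟨ha, H, hA⟩ | ⟨ha, hA, hq, H⟩ <;>
  rcases H1 with ⟨ha1, H1⟩ | ⟨ha1, H1, hA1⟩ | ⟨ha1, hA1, hq1, H1⟩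
  · have o := @slot_odd M a' c' (by omega)
    have o1 := @slot_even M a' (c' + 1) hal' (by omega)
    rw [← hs'] at o
    rw [← ht'] at o1
    omega
  · omega
  · omega
  · omega
  · have o := @slot_odd M a' c' (by omega)
    have o1 := @slot_even M a' (c' + 1) hal' (by omega)
    rw [← hs'] at o
    rw [← ht'] at o1
    omega
  · have : s / 4 ≠ t / 4 := fun h => hA (h ▸ hA1)
    have o := @slot_odd M a' c' (by omega)
    have o1 := @slot_even M a' (c' + 1) hal' (by omega)
    rw [← hs'] at o
    rw [← ht'] at o1
    omega
  · omega
  · have : s / 4 ≠ t / 4 := fun h => hA1 (h ▸ hA)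
    have o := @slot_odd M a' c' (by omega)
    have o1 := @slot_even M a' (c' + 1) hal' (by omega)
    rw [← hs'] at o
    rw [← ht'] at o1
    omega
  · have := active_bounds hM hA
    have := active_bounds hM hA1
    have := active_gap hM hA hA1
    have := active_gap hM hA1 hA
    have o := @slot_parity M a' c' hal'
    refine ⟨by omega, by omega, by omega, ?_⟩
    by_contra
    rcases Nat.mod_two_eq_zero_or_one c' with q | q
    · have q0 := @slot_even M a' c' hal' q
      have q1 := @slot_odd M a' (c' + 1) (by omega)
      rw [← hs'] at q0
      rw [← ht'] at q1
      clear hs hs' ht ht'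
      omega
    · have q0 := @slot_odd M a' c' q
      have q1 := @slot_even M a' (c' + 1) hal' (by omega)
      rw [← hs'] at q0
      rw [← ht'] at q1
      clear hs hs' ht ht'
      omega

theorem no_triple {M R c D c' : ℕ} (hM : 56 ≤ M) (hD : 1 ≤ D) (hD' : D ≤ 15)
    (h : value M R c = value M (R + D) c')
    (h1 : value M R (c + 1) = value M (R + D) (c' + 1))
    (h2 : value M R (c + 2) = value M (R + D) (c' + 2)) : False := by
  have hrM : 2 * ring M = M + 2 ∨ 2 * ring M = M + 3 := by unfold ring; omega
  have ha := Nat.mod_lt R (by omega : ring M > 0)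
  rcases Nat.mod_two_eq_zero_or_one c with h0 | h0
  · obtain ⟨a1, a2, a3, -⟩ := pair_even hM hD hD' h0 h h1
    obtain ⟨b1, b2, b3, -⟩ := pair_odd hM hD hD' (by omega) h1 h2
    have e := @slot_even M (R % ring M) c ha h0
    have e2 := @slot_even M (R % ring M) (c + 1 + 1) ha (by omega)
    omega
  · obtain ⟨a1, a2, a3, -⟩ := pair_odd hM hD hD' h0 h h1
    obtain ⟨b1, b2, b3, -⟩ := pair_even hM hD hD' (by omega) h1 h2
    have e := @slot_odd M (R % ring M) c h0
    have e2 := @slot_odd M (R % ring M) (c + 1 + 1) (by omega)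
    omega

/-- The letter at position `p`, as a positive number. -/
def val (M p : ℕ) : ℕ := value M (p / M) (p % M)

theorem div_mod_add {M : ℕ} (hM : 0 < M) (p q : ℕ) :
    (p + q) / M = p / M + q / M ∧ (p + q) % M = p % M + q % M ∨
      (p + q) / M = p / M + (q / M + 1) ∧ (p + q) % M + M = p % M + q % M := by
  have h1 := Nat.add_div (a := p) (b := q) hM
  have h2 := Nat.add_mod_add_ite p q M
  split_ifs at h1 h2 <;> omega

theorem div_mod_succ {M : ℕ} (hM : 1 < M) (p : ℕ) :
    (p + 1) / M = p / M ∧ (p + 1) % M = p % M + 1 ∧ p % M + 1 < M ∨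
      (p + 1) / M = p / M + 1 ∧ (p + 1) % M = 0 ∧ p % M + 1 = M := by
  have h := div_mod_add (by omega : 0 < M) p 1
  rw [Nat.div_eq_of_lt hM, Nat.mod_eq_of_lt hM] at h
  have h1 := Nat.mod_lt (p + 1) (by omega : M > 0)
  have h2 := Nat.mod_lt p (by omega : M > 0)
  omega

theorem ring_pos (M : ℕ) : 0 < ring M := by unfold ring; omega

/-- Letters outside the permuted classes are equal only if they occupy the same slot. -/
theorem slot_eq_of_inactive {M R c R' c' : ℕ} (hM : 56 ≤ M) (hR : R ≤ R')
    (h : value M R c = value M R' c')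
    (hs : slot M (R % ring M) c / 4 = 0 ∨ M / 4 ≤ slot M (R % ring M) c / 4 ∨
      slot M (R' % ring M) c' / 4 = 0 ∨ M / 4 ≤ slot M (R' % ring M) c' / 4) :
    slot M (R % ring M) c = slot M (R' % ring M) c' := by
  obtain ⟨h1, h2⟩ := eq_of_value_eq hR h
  rw [turns_eq_zero hM (by omega), turns_eq_zero hM (by omega)] at h2
  simp only [Nat.sub_zero, Nat.zero_mod, Function.iterate_zero, id] at h2
  omega

/-- A column whose letter is never permuted. -/
def Fixed (M c : ℕ) : Prop := c % 2 = 1 ∧ (c = 1 ∨ 4 * (M / 4) ≤ c + 1)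

theorem eq_of_fixed {M R c R' c' : ℕ} (hM : 56 ≤ M) (hR : R ≤ R')
    (h : value M R c = value M R' c') (hc : Fixed M c ∨ Fixed M c') : c = c' := by
  have ha := Nat.mod_lt R (ring_pos M)
  have ha' := Nat.mod_lt R' (ring_pos M)
  have p := @slot_parity M _ c ha
  have p' := @slot_parity M _ c' ha'
  unfold Fixed at hc
  rcases hc with ⟨h1, h2⟩ | ⟨h1, h2⟩
  · have e := @slot_odd M (R % ring M) c h1
    have := slot_eq_of_inactive hM hR h (by omega)
    have e' := @slot_odd M (R' % ring M) c' (by omega)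
    omega
  · have e' := @slot_odd M (R' % ring M) c' h1
    have := slot_eq_of_inactive hM hR h (by omega)
    have e := @slot_odd M (R % ring M) c (by omega)
    omega

theorem not_fixed {M p q : ℕ} (hM : 56 ≤ M) (hq : q % M ≠ 0) (h : val M p = val M (p + q)) :
    ¬ Fixed M (p % M) ∧ ¬ Fixed M ((p + q) % M) := by
  have := div_mod_add (by omega : 0 < M) p q
  have h1 := Nat.mod_lt (p + q) (by omega : M > 0)
  have h2 := Nat.mod_lt q (by omega : M > 0)
  by_contra hf
  have := eq_of_fixed hM (Nat.div_le_div_right (Nat.le_add_right p q)) h (by tauto)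
  omega

/-- Long matches at a distance that is not a whole number of rows stay inside the rows. -/
theorem no_wrap {M p q : ℕ} (hM : 56 ≤ M) (hq : q % M ≠ 0) (h0 : val M p = val M (p + q))
    (h1 : val M (p + 1) = val M (p + 1 + q)) (h2 : val M (p + 1 + 1) = val M (p + 1 + 1 + q)) :
    p % M + 2 < M ∧ (p + q) % M + 2 < M := by
  have f0 := not_fixed hM hq h0
  have f1 := not_fixed hM hq h1
  have f2 := not_fixed hM hq h2
  rw [Nat.add_right_comm p 1 q] at *
  rw [Nat.add_right_comm (p + 1) 1 q, Nat.add_right_comm p 1 q] at *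
  have a1 := div_mod_succ (by omega : 1 < M) p
  have a2 := div_mod_succ (by omega : 1 < M) (p + 1)
  have b1 := div_mod_succ (by omega : 1 < M) (p + q)
  have b2 := div_mod_succ (by omega : 1 < M) (p + q + 1)
  unfold Fixed at *
  omega

theorem mod_two_eq_one_of_near {M R c D : ℕ} (hM : 56 ≤ M) (hD : 1 ≤ D) (hD' : D ≤ 15)
    (h : value M R c = value M (R + D) c) : c % 2 = 1 ∨ 
      D = 1 ∧ R % ring M + 1 = ring M ∧ 4 ≤ slot M (R % ring M) c := by
  have hrM : 2 * ring M = M + 2 ∨ 2 * ring M = M + 3 := by unfold ring; omega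
  obtain ⟨a, a', s, s', ha, ha', hal, hal', hs, hs', H⟩ := near (by omega : D < ring M) h
  rcases Nat.mod_two_eq_zero_or_one c with h0 | h0
  · right
    have e := @slot_even M a c hal h0
    have e' := @slot_even M a' c hal' h0
    rw [← hs] at e
    rw [← hs'] at e'
    rw [← ha, ← hs]
    clear hs hs' ha ha' h
    rcases H with ⟨ha, H⟩ | ⟨ha, H, hA⟩ | ⟨ha, hA, hq, H⟩
    · omega
    · omega
    · have := active_bounds hM hA
      omega
  · exact Or.inl h0

theorem run_lt_three {M p q : ℕ} (hM : 56 ≤ M) (hq : 2 * M ≤ q) (hq' : q < 15 * M)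
    (h0 : val M p = val M (p + q)) (h1 : val M (p + 1) = val M (p + 1 + q))
    (h2 : val M (p + 1 + 1) = val M (p + 1 + 1 + q)) : False := by
  have g1 : 2 ≤ q / M := by rw [Nat.le_div_iff_mul_le (by omega)]; exact hq
  have g2 : q / M < 15 := by rw [Nat.div_lt_iff_lt_mul (by omega)]; exact hq'
  have p0 := div_mod_add (by omega : 0 < M) p q
  have p1 := div_mod_add (by omega : 0 < M) (p + 1) q
  have a1 := div_mod_succ (by omega : 1 < M) p
  have a2 := div_mod_succ (by omega : 1 < M) (p + 1)
  by_cases hg : q % M = 0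
  · have l0 := Nat.mod_lt (p + q) (by omega : M > 0)
    have l1 := Nat.mod_lt (p + 1 + q) (by omega : M > 0)
    have l2 := Nat.mod_lt (p + 1 + 1 + q) (by omega : M > 0)
    have p2 := div_mod_add (by omega : 0 < M) (p + 1 + 1) q
    unfold val at h0 h1 h2
    rw [show (p + q) / M = p / M + q / M by omega, show (p + q) % M = p % M by omega] at h0
    rw [show (p + 1 + q) / M = (p + 1) / M + q / M by omega,
      show (p + 1 + q) % M = (p + 1) % M by omega] at h1
    rw [show (p + 1 + 1 + q) / M = (p + 1 + 1) / M + q / M by omega,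
      show (p + 1 + 1 + q) % M = (p + 1 + 1) % M by omega] at h2
    have m0 := mod_two_eq_one_of_near hM (by omega) (by omega) h0
    have m1 := mod_two_eq_one_of_near hM (by omega) (by omega) h1
    have m2 := mod_two_eq_one_of_near hM (by omega) (by omega) h2
    omega
  · obtain ⟨w, w'⟩ := no_wrap hM hg h0 h1 h2
    rw [Nat.add_right_comm p 1 q] at *
    rw [Nat.add_right_comm (p + 1) 1 q, Nat.add_right_comm p 1 q] at *
    have b1 := div_mod_succ (by omega : 1 < M) (p + q)
    have b2 := div_mod_succ (by omega : 1 < M) (p + q + 1)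
    unfold val at h0 h1 h2
    obtain ⟨D, hD⟩ : ∃ D, D = (p + q) / M - p / M := ⟨_, rfl⟩
    rw [show (p + q) / M = p / M + D by omega] at h0
    rw [show (p + q + 1) / M = p / M + D by omega, show (p + 1) / M = p / M by omega,
      show (p + 1) % M = p % M + 1 by omega,
      show (p + q + 1) % M = (p + q) % M + 1 by omega] at h1
    rw [show (p + q + 1 + 1) / M = p / M + D by omega, show (p + 1 + 1) / M = p / M by omega,
      show (p + 1 + 1) % M = p % M + 2 by omega,
      show (p + q + 1 + 1) % M = (p + q) % M + 2 by omega] at h2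
    exact no_triple hM (by omega) (by omega) h0 h1 h2

theorem run_lt_one {M p q : ℕ} (hM : 56 ≤ M) (hq : 1 ≤ q) (hq' : q < M)
    (h : val M p = val M (p + q)) : False := by
  have p0 := div_mod_add (by omega : 0 < M) p q
  rw [Nat.div_eq_of_lt hq', Nat.mod_eq_of_lt hq'] at p0
  have l0 := Nat.mod_lt (p + q) (by omega : M > 0)
  have l1 := Nat.mod_lt p (by omega : M > 0)
  have hrM : 2 * ring M = M + 2 ∨ 2 * ring M = M + 3 := by unfold ring; omega
  unfold val at h
  obtain ⟨D, hD⟩ : ∃ D, D = (p + q) / M - p / M := ⟨_, rfl⟩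
  rw [show (p + q) / M = p / M + D by omega] at h
  obtain ⟨a, a', s, s', -, -, hal, hal', hs, hs', H⟩ := near (by omega : D < ring M) h
  have e := @slot_parity M a (p % M) hal
  have e' := @slot_parity M a' ((p + q) % M) hal'
  rw [← hs] at e
  rw [← hs'] at e'
  have o := fun h => @slot_odd M a (p % M) h
  have o' := fun h => @slot_odd M a' ((p + q) % M) h
  have v := fun h => @slot_even M a (p % M) hal h
  have v' := fun h => @slot_even M a' ((p + q) % M) hal' h
  rw [← hs] at o v
  rw [← hs'] at o' v'
  clear hs hs' h
  generalize (p + q) / M = R' at *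
  generalize p / M = R at *
  generalize (p + q) % M = c' at *
  generalize p % M = c at *
  rcases Nat.mod_two_eq_zero_or_one c with h0 | h0 <;>
  rcases Nat.mod_two_eq_zero_or_one c' with h1 | h1 <;>
  simp only [h0, h1, true_implies, zero_ne_one, one_ne_zero, false_implies] at o o' v v' <;>
  rcases H with ⟨ha, H⟩ | ⟨ha, H, -⟩ | ⟨ha, hA, hq, H⟩ <;>
  omega

theorem pair {M R c D c' : ℕ} (hM : 56 ≤ M) (hD : 1 ≤ D) (hD' : D ≤ 15)
    (h : value M R c = value M (R + D) c')
    (h1 : value M R (c + 1) = value M (R + D) (c' + 1)) : 3 ≤ D ∨ D = 2 ∧ c ≤ c' := by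
  rcases Nat.mod_two_eq_zero_or_one c with h0 | h0
  · exact (pair_even hM hD hD' h0 h h1).2.2.2
  · exact (pair_odd hM hD hD' h0 h h1).2.2.2

theorem first_col {M R c' : ℕ} (hM : 56 ≤ M) (hc' : c' < M)
    (h : value M R 0 = value M (R + 1) c') : c' = 2 := by
  have hrM : 2 * ring M = M + 2 ∨ 2 * ring M = M + 3 := by unfold ring; omega
  obtain ⟨a, a', s, s', -, -, hal, hal', hs, hs', H⟩ := near (by omega : 1 < ring M) h
  have e' := @slot_parity M a' c' hal'
  have o' := fun h => @slot_odd M a' c' h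
  have v := @slot_even M a 0 hal rfl
  have v' := fun h => @slot_even M a' c' hal' h
  rw [← hs] at v
  rw [← hs'] at o' v' e'
  clear hs hs' h
  rcases H with ⟨ha, H⟩ | ⟨ha, H, -⟩ | ⟨ha, hA, hq, H⟩
  · omega
  · omega
  · have := active_bounds hM hA
    omega

theorem first_col' {M R c : ℕ} (hM : 56 ≤ M) (hc : c < M)
    (h : value M R c = value M (R + 2) 0) : c + 1 = M ∨ c + 2 = M := by
  have hrM : 2 * ring M = M + 2 ∨ 2 * ring M = M + 3 := by unfold ring; omega
  obtain ⟨a, a', s, s', -, -, hal, hal', hs, hs', H⟩ := near (by omega : 2 < ring M) h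
  have e := @slot_parity M a c hal
  have o := fun h => @slot_odd M a c h
  have v := fun h => @slot_even M a c hal h
  have v' := @slot_even M a' 0 hal' rfl
  rw [← hs] at o v e
  rw [← hs'] at v'
  clear hs hs' h
  rcases H with ⟨ha, H⟩ | ⟨ha, H, -⟩ | ⟨ha, hA, hq, H⟩
  · omega
  · omega
  · have := active_bounds hM hA
    omega

theorem run_lt_two {M p q : ℕ} (hM : 56 ≤ M) (hq : M ≤ q) (hq' : q < 2 * M)
    (h0 : val M p = val M (p + q)) (h1 : val M (p + 1) = val M (p + 1 + q)) : False := by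
  have hrM : 2 * ring M = M + 2 ∨ 2 * ring M = M + 3 := by unfold ring; omega
  have g1 : 1 ≤ q / M := by rw [Nat.le_div_iff_mul_le (by omega)]; omega
  have g2 : q / M < 2 := by rw [Nat.div_lt_iff_lt_mul (by omega)]; exact hq'
  have p0 := div_mod_add (by omega : 0 < M) p q
  have a1 := div_mod_succ (by omega : 1 < M) p
  have f0 := fun h => not_fixed hM h h0
  have f1 := fun h => not_fixed hM h h1
  rw [Nat.add_right_comm p 1 q] at *
  have b1 := div_mod_succ (by omega : 1 < M) (p + q)
  unfold Fixed at f0 f1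
  unfold val at h0 h1
  have l0 := Nat.mod_lt (p + q) (by omega : M > 0)
  have l1 := Nat.mod_lt p (by omega : M > 0)
  have l2 := Nat.mod_lt q (by omega : M > 0)
  generalize (p + q) / M = R' at *
  generalize (p + 1) / M = R1 at *
  generalize (p + q + 1) / M = R1' at *
  generalize p / M = R at *
  generalize (p + q) % M = c' at *
  generalize (p + q + 1) % M = c1' at *
  generalize (p + 1) % M = c1 at *
  generalize p % M = c at *
  generalize q / M = h at *
  generalize q % M = g at *
  obtain rfl : h = 1 := by omega
  rcases a1 with ⟨rfl, rfl, hc⟩ | ⟨rfl, rfl, hc⟩ <;>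
  rcases b1 with ⟨rfl, rfl, hc'⟩ | ⟨rfl, rfl, hc'⟩
  · rcases p0 with ⟨rfl, rfl⟩ | ⟨rfl, hg⟩
    · have := pair hM (by omega) (by omega) h0 h1
      omega
    · have := pair hM (by omega) (by omega) h0 h1
      omega
  · rw [show R' = R1 + 1 by omega] at h1
    have := first_col' hM (by omega) h1
    omega
  · rw [show R1' = R + 2 by omega] at h1
    have := first_col hM (by omega) h1
    omega
  · rw [show R' = R + 1 by omega] at h1
    have := first_col hM (by omega) h1
    omega

theorem turn_one_three : ∀ d < 4, ¬ (0 = turn^[d] 1 ∧ 2 = turn^[d] 3) := by decide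

theorem turn_fixed : ∀ d < 4, ∀ r < 4, r = turn^[d] r → d = 0 := by decide

theorem odd_columns {M R R' c c' : ℕ} (hM : 56 ≤ M) (hR : R ≤ R') (hc : c % 2 = 1) (hcc : c ≠ c')
    (h0 : value M R c = value M R' c') (h1 : value M R (c + 2) = value M R' (c' + 2))
    (h2 : value M R (c + 4) = value M R' (c' + 4)) : False := by
  have ha' := Nat.mod_lt R' (ring_pos M)
  have i0 := slot_eq_of_inactive hM hR h0
  have i1 := slot_eq_of_inactive hM hR h1
  have i2 := slot_eq_of_inactive hM hR h2
  obtain ⟨e0, f0⟩ := eq_of_value_eq hR h0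
  obtain ⟨e1, f1⟩ := eq_of_value_eq hR h1
  obtain ⟨e2, f2⟩ := eq_of_value_eq hR h2
  rw [slot_odd (by omega)] at i0 e0 f0 i1 e1 f1 i2 e2 f2
  rcases Nat.mod_two_eq_zero_or_one c' with h | h
  · have v0 := @slot_even M (R' % ring M) c' ha' (by omega)
    have v1 := @slot_even M (R' % ring M) (c' + 2) ha' (by omega)
    have v2 := @slot_even M (R' % ring M) (c' + 4) ha' (by omega)
    generalize slot M (R' % ring M) c' = s0 at *
    generalize slot M (R' % ring M) (c' + 2) = s1 at *
    generalize slot M (R' % ring M) (c' + 4) = s2 at *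
    by_cases hs : (c + 1) % 4 = 0
    · rw [show (c + 2 + 1) / 4 = (c + 1) / 4 by omega, show (c + 2 + 1) % 4 = 2 by omega,
        show s1 % 4 = 3 by omega] at f1
      rw [hs, show s0 % 4 = 1 by omega] at f0
      exact turn_one_three _ (Nat.mod_lt _ (by norm_num)) ⟨f0, f1⟩
    · rw [show (c + 4 + 1) / 4 = (c + 2 + 1) / 4 by omega, show (c + 4 + 1) % 4 = 2 by omega,
        show s2 % 4 = 3 by omega] at f2
      rw [show (c + 2 + 1) % 4 = 0 by omega, show s1 % 4 = 1 by omega] at f1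
      exact turn_one_three _ (Nat.mod_lt _ (by norm_num)) ⟨f1, f2⟩
  · rw [slot_odd (by omega)] at e0 e1
    omega

theorem even_columns {M R R' c : ℕ} (hM : 56 ≤ M) (hR : R ≤ R') (hc : c % 2 = 0)
    (ha : R % ring M ≠ R' % ring M)
    (h0 : value M R c = value M R' c) (h1 : value M R (c + 2) = value M R' (c + 2)) : False := by
  have hal := Nat.mod_lt R (ring_pos M)
  have hal' := Nat.mod_lt R' (ring_pos M)
  have i0 := slot_eq_of_inactive hM hR h0
  have i1 := slot_eq_of_inactive hM hR h1
  obtain ⟨e0, -⟩ := eq_of_value_eq hR h0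
  obtain ⟨e1, -⟩ := eq_of_value_eq hR h1
  have v0 := @slot_even M _ c hal (by omega)
  have v1 := @slot_even M _ (c + 2) hal (by omega)
  have w0 := @slot_even M _ c hal' (by omega)
  have w1 := @slot_even M _ (c + 2) hal' (by omega)
  omega

theorem div_mod_add_lt {M p k : ℕ} (h : p % M + k < M) :
    (p + k) / M = p / M ∧ (p + k) % M = p % M + k := by
  have := div_mod_add (by omega : 0 < M) p k
  rw [Nat.div_eq_of_lt (by omega : k < M), Nat.mod_eq_of_lt (by omega : k < M)] at this
  omega

theorem val_add {M p k : ℕ} (h : p % M + k < M) : val M (p + k) = value M (p / M) (p % M + k) := by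
  rw [val, (div_mod_add_lt h).1, (div_mod_add_lt h).2]

theorem run_lt_six {M p q : ℕ} (hM : 56 ≤ M) (hq : q % M ≠ 0)
    (h : ∀ k < 6, val M (p + k) = val M (p + k + q)) : False := by
  have n0 := no_wrap hM hq (h 0 (by omega)) (h 1 (by omega)) (h 2 (by omega))
  have n1 := no_wrap hM hq (h 1 (by omega)) (h 2 (by omega)) (h 3 (by omega))
  have n2 := no_wrap hM hq (h 2 (by omega)) (h 3 (by omega)) (h 4 (by omega))
  have n3 := no_wrap hM hq (h 3 (by omega)) (h 4 (by omega)) (h 5 (by omega))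
  simp only [Nat.add_zero] at n0
  rw [Nat.add_right_comm] at n1 n2 n3
  have a := fun k (hk : k < 3) => div_mod_add_lt (M := M) (p := p) (k := k) (by omega)
  have b := fun k (hk : k < 3) => div_mod_add_lt (M := M) (p := p + q) (k := k) (by omega)
  have a1 := (a 1 (by omega)).2
  have a2 := (a 2 (by omega)).2
  have b1 := (b 1 (by omega)).2
  have b2 := (b 2 (by omega)).2
  have a3 := (div_mod_add_lt (M := M) (p := p) (k := 3) (by omega)).2
  have b3 := (div_mod_add_lt (M := M) (p := p + q) (k := 3) (by omega)).2
  have g : ∀ k < 6, value M (p / M) (p % M + k) = value M ((p + q) / M) ((p + q) % M + k) := by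
    intro k hk
    rw [← val_add (by omega), ← val_add (by omega), h k hk, Nat.add_right_comm]
  have hR : p / M ≤ (p + q) / M := Nat.div_le_div_right (Nat.le_add_right p q)
  have hc : p % M ≠ (p + q) % M := by
    have := div_mod_add (by omega : 0 < M) p q
    have := Nat.mod_lt q (by omega : M > 0)
    omega
  rcases Nat.mod_two_eq_zero_or_one (p % M) with hp | hp
  · exact odd_columns hM hR (by omega) (by omega) (g 1 (by omega)) (g 3 (by omega))
      (g 5 (by omega))
  · exact odd_columns hM hR hp hc (g 0 (by omega)) (g 2 (by omega)) (g 4 (by omega))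

theorem div_mod_add_mul {M : ℕ} (hM : 0 < M) (p h : ℕ) :
    (p + h * M) / M = p / M + h ∧ (p + h * M) % M = p % M :=
  ⟨Nat.add_mul_div_right _ _ hM, Nat.add_mul_mod_self_right _ _ _⟩

theorem run_lt_seven {M p h : ℕ} (hM : 56 ≤ M) (hh : ¬ ring M ∣ h)
    (H : ∀ k < 7, val M (p + k) = val M (p + k + h * M)) : False := by
  have key : ∀ p, p % M + 3 < M → (∀ k < 4, val M (p + k) = val M (p + k + h * M)) → False := by
    intro p hp H
    have g : ∀ k < 4, value M (p / M) (p % M + k) = value M (p / M + h) (p % M + k) := by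
      intro k hk
      rw [← val_add (by omega), H k hk, val, (div_mod_add_mul (by omega) _ _).1,
        (div_mod_add_mul (by omega) _ _).2, (div_mod_add_lt (by omega)).1,
        (div_mod_add_lt (by omega)).2]
    have ha : (p / M) % ring M ≠ (p / M + h) % ring M := fun e =>
      hh (by simpa using (Nat.modEq_iff_dvd' (Nat.le_add_right _ _)).1 e)
    rcases Nat.mod_two_eq_zero_or_one (p % M) with hp | hp
    · exact even_columns hM (Nat.le_add_right _ _) hp ha (g 0 (by omega)) (g 2 (by omega))
    · exact even_columns hM (Nat.le_add_right _ _) (by omega) ha (g 1 (by omega)) (g 3 (by omega))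
  by_cases hp : p % M + 3 < M
  · exact key p hp fun k hk => H k (by omega)
  · refine key (p + 3) ?_ fun k hk => by rw [Nat.add_assoc p 3 k]; exact H (3 + k) (by omega)
    have := div_mod_add (by omega : 0 < M) p 3
    rw [Nat.mod_eq_of_lt (by omega : 3 < M)] at this
    have := Nat.mod_lt p (by omega : M > 0)
    have := Nat.mod_lt (p + 3) (by omega : M > 0)
    omega

/-- At a distance of `j` blocks, a match in an odd column needs a full number of rotations. -/
theorem turns_of_match {M j P y r : ℕ} (hM : 0 < M) (hr : r < 4) (hr' : r % 2 = 0)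
    (hP : P % M + 1 = 4 * y + r) (h : val M P = val M (P + j * ring M * M)) :
    (turns M y (P / M / ring M + j) - turns M y (P / M / ring M)) % 4 = 0 := by
  unfold val at h
  rw [(div_mod_add_mul hM _ _).1, (div_mod_add_mul hM _ _).2] at h
  have := (eq_of_value_eq (Nat.le_add_right _ _) h).2
  rw [slot_odd (by omega), slot_odd (by omega), hP, (div_mod_add_mul (ring_pos M) _ _).1,
    show (4 * y + r) / 4 = y by omega, show (4 * y + r) % 4 = r by omega] at this
  exact turn_fixed _ (Nat.mod_lt _ (by norm_num)) _ hr this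

theorem turns_of_active {M y : ℕ} (h : ∀ x, Active M y x) (i : ℕ) : turns M y i = i := by
  induction i with
  | zero => rfl
  | succ i ih => rw [turns_succ, if_pos (h _), ih]

theorem run_le_ring {M p j : ℕ} (hM : 56 ≤ M) (hj : ¬ 4 ∣ j)
    (H : ∀ k ≤ ring M, val M (p + k) = val M (p + k + j * ring M * M)) : False := by
  have key : ∀ y r k, r < 4 → r % 2 = 0 → (∀ x, Active M y x) → k ≤ ring M →
      (p + k) % M + 1 = 4 * y + r → False := by
    intro y r k hr hr' hy hk e
    have := turns_of_match (by omega) hr hr' e (H k hk)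
    rw [turns_of_active hy, turns_of_active hy] at this
    omega
  have hrM : 2 * ring M = M + 2 ∨ 2 * ring M = M + 3 := by unfold ring; omega
  have y1 : ∀ x, Active M 1 x := fun x => Or.inl rfl
  have y2 : ∀ x, Active M (M / 8 + 1) x := fun x => Or.inr (Or.inl rfl)
  have hp := Nat.mod_lt p (by omega : M > 0)
  have hk : ∀ t < M, p % M ≤ t → (p + (t - p % M)) % M = t := by
    intro t ht h
    rw [(div_mod_add_lt (by omega)).2]
    omega
  rcases (by omega : p % M ≤ 3 ∨ 3 < p % M ∧ p % M ≤ 5 ∨ 5 < p % M ∧ p % M ≤ 4 * (M / 8) + 3 ∨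
    4 * (M / 8) + 3 < p % M ∧ p % M ≤ 4 * (M / 8) + 5 ∨ 4 * (M / 8) + 5 < p % M) with
    h | h | h | h | h
  · exact key 1 0 _ (by norm_num) rfl y1 (by omega) (congrArg (· + 1) (hk 3 (by omega) (by omega)))
  · exact key 1 2 _ (by norm_num) rfl y1 (by omega) (congrArg (· + 1) (hk 5 (by omega) (by omega)))
  · exact key _ 0 _ (by norm_num) rfl y2 (by omega)
      (congrArg (· + 1) (hk (4 * (M / 8) + 3) (by omega) (by omega)))
  · exact key _ 2 _ (by norm_num) rfl y2 (by omega)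
      (congrArg (· + 1) (hk (4 * (M / 8) + 5) (by omega) (by omega)))
  · refine key 1 0 (M + 3 - p % M) (by norm_num) rfl y1 (by omega) ?_
    have := div_mod_add (by omega : 0 < M) p (M + 3 - p % M)
    rw [Nat.mod_eq_of_lt (by omega : M + 3 - p % M < M)] at this
    have := Nat.mod_lt (p + (M + 3 - p % M)) (by omega : M > 0)
    omega

/-- The number of indices in `(a, b]` whose binary valuation is `r` modulo `m`. -/
def levels (m r a b : ℕ) : ℕ :=
  ((Finset.Ioc a b).filter fun y => padicValNat 2 y % m = r % m).card

/-- The number of odd indices in `(a, b]`. -/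
def odds (a b : ℕ) : ℕ := ((Finset.Ioc a b).filter fun y => y % 2 = 1).card

theorem odds_eq {a b : ℕ} (h : a ≤ b) : odds a b + (a + 1) / 2 = (b + 1) / 2 := by
  induction b, h using Nat.le_induction with
  | base => simp [odds]
  | succ b hb ih =>
    have : Finset.Ioc a (b + 1) = insert (b + 1) (Finset.Ioc a b) := by
      ext t; simp only [Finset.mem_Ioc, Finset.mem_insert]; omega
    unfold odds at *
    rw [this, Finset.filter_insert]
    split_ifs with h
    · rw [Finset.card_insert_of_notMem (by simp)]; omega
    · omega

theorem valuation_two_mul {y : ℕ} (h : 0 < y) : padicValNat 2 (2 * y) = padicValNat 2 y + 1 := by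
  rw [padicValNat.mul (by norm_num) (by omega), padicValNat.self (by norm_num), Nat.add_comm]

theorem valuation_odd {y : ℕ} (h : y % 2 = 1) : padicValNat 2 y = 0 :=
  padicValNat.eq_zero_of_not_dvd (by omega)

/-- Counting even indices by halving them. -/
theorem levels_succ (m r a b : ℕ) :
    levels m (r + 1) a b =
      (if (r + 1) % m = 0 then odds a b else 0) + levels m r (a / 2) (b / 2) := by
  have h1 : ((Finset.Ioc a b).filter fun y => padicValNat 2 y % m = (r + 1) % m) =
      ((Finset.Ioc a b).filter fun y => y % 2 = 1 ∧ (r + 1) % m = 0) ∪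
        ((Finset.Ioc (a / 2) (b / 2)).filter fun y => padicValNat 2 y % m = r % m).image
          (2 * ·) := by
    ext y
    simp only [Finset.mem_union, Finset.mem_filter, Finset.mem_Ioc, Finset.mem_image]
    rcases Nat.mod_two_eq_zero_or_one y with hy | hy
    · obtain ⟨x, rfl⟩ : ∃ x, y = 2 * x := ⟨y / 2, by omega⟩
      constructor
      · rintro ⟨h, h'⟩
        rw [valuation_two_mul (by omega)] at h'
        exact Or.inr ⟨x, ⟨by omega, Nat.ModEq.add_right_cancel' 1 h'⟩, rfl⟩
      · rintro (⟨h, h', h''⟩ | ⟨z, ⟨h, h'⟩, hz⟩)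
        · omega
        · obtain rfl : z = x := by omega
          rw [valuation_two_mul (by omega)]
          exact ⟨by omega, Nat.ModEq.add_right 1 h'⟩
    · rw [valuation_odd hy, Nat.zero_mod]
      constructor
      · rintro ⟨h, h'⟩
        exact Or.inl ⟨h, hy, h'.symm⟩
      · rintro (⟨h, h', h''⟩ | ⟨z, ⟨h, h'⟩, hz⟩)
        · exact ⟨h, h''.symm⟩
        · omega
  unfold levels
  rw [h1, Finset.card_union_of_disjoint, Finset.card_image_of_injective]
  · congr 1
    split_ifs with h
    · simp [h, odds]
    · simp [h]
  · intro x y h; simpa using h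
  · rw [Finset.disjoint_left]
    intro y hy hy'
    simp only [Finset.mem_filter, Finset.mem_image] at hy hy'
    obtain ⟨z, -, rfl⟩ := hy'
    omega

theorem levels_add (m r k a b : ℕ) (h : r + k < m) :
    levels m (r + k) a b = levels m r (a / 2 ^ k) (b / 2 ^ k) := by
  induction k generalizing a b with
  | zero => simp
  | succ k ih =>
    rw [← Nat.add_assoc, levels_succ, if_neg (by rw [Nat.mod_eq_of_lt (by omega)]; omega), Nat.zero_add,
      ih _ _ (by omega), Nat.div_div_eq_div_mul, Nat.div_div_eq_div_mul, Nat.pow_succ']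

/-- A short window has too few indices for the level counts of an odd number of steps. -/
theorem seven_le {m a b : ℕ} (hm : 3 ≤ m) (hab : a ≤ b) (h0 : levels m 0 a b % 4 = 0)
    (h1 : levels m 1 a b % 4 = 2) (h2 : levels m 2 a b % 2 = 1) : 7 ≤ b - a := by
  have hd : odds a b ≤ levels m 0 a b := by
    refine Finset.card_le_card fun y hy => ?_
    rw [Finset.mem_filter] at hy ⊢
    rw [valuation_odd hy.2]
    exact ⟨hy.1, rfl⟩
  have hs : levels m 0 a b + levels m 1 a b + levels m 2 a b ≤ b - a := by
    unfold levels
    rw [← Nat.card_Ioc, ← Finset.card_union_of_disjoint, ← Finset.card_union_of_disjoint]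
    · exact Finset.card_le_card (by intro y; simp only [Finset.mem_union, Finset.mem_filter]; tauto)
    · rw [Finset.disjoint_left]
      intro y
      simp only [Finset.mem_union, Finset.mem_filter, Nat.mod_eq_of_lt (by omega : 0 < m),
        Nat.mod_eq_of_lt (by omega : 1 < m), Nat.mod_eq_of_lt (by omega : 2 < m)]
      omega
    · rw [Finset.disjoint_left]
      intro y
      simp only [Finset.mem_filter, Nat.mod_eq_of_lt (by omega : 0 < m),
        Nat.mod_eq_of_lt (by omega : 1 < m)]
      omega
  have := odds_eq hab
  omega

theorem window_large {m u : ℕ} (hm : 8 ≤ m) (hu : u % 2 = 1) (a : ℕ)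
    (h : ∀ r, levels m r a (a + 4 * u) % 4 = 0) : 3 * 2 ^ (m - 2) < u := by
  have e1 : ∀ r, levels m (r + 1) a (a + 4 * u) =
      (if (r + 1) % m = 0 then 2 * u else 0) + levels m r (a / 2) (a / 2 + 2 * u) := by
    intro r
    have := odds_eq (Nat.le_add_right a (4 * u))
    rw [levels_succ, show (a + 4 * u) / 2 = a / 2 + 2 * u by omega,
      show odds a (a + 4 * u) = 2 * u by omega]
  have e2 : ∀ r, levels m (r + 1) (a / 2) (a / 2 + 2 * u) =
      (if (r + 1) % m = 0 then u else 0) + levels m r (a / 2 / 2) (a / 2 / 2 + u) := by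
    intro r
    have := odds_eq (Nat.le_add_right (a / 2) (2 * u))
    rw [levels_succ, show (a / 2 + 2 * u) / 2 = a / 2 / 2 + u by omega,
      show odds (a / 2) (a / 2 + 2 * u) = u by omega]
  generalize a / 2 / 2 = b at *
  have e3 : ∀ r, r ≤ 2 → levels m (r + (m - 3)) b (b + u) =
      levels m r (b / 2 ^ (m - 3)) ((b + u) / 2 ^ (m - 3)) := fun r hr =>
    levels_add m r (m - 3) b (b + u) (by omega)
  have g : ∀ r, (if (r + 2) % m = 0 then 2 * u else 0) + ((if (r + 1) % m = 0 then u else 0) +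
      levels m r b (b + u)) = levels m (r + 2) a (a + 4 * u) := by
    intro r; rw [e1, e2]
  have f0 := g (0 + (m - 3))
  have f1 := g (1 + (m - 3))
  have f2 := g (2 + (m - 3))
  rw [e3 _ (by omega), if_neg, if_neg] at f0
  · rw [e3 _ (by omega), if_pos, if_neg] at f1
    · rw [e3 _ (by omega), if_neg, if_pos] at f2
      · have q0 := h (0 + (m - 3) + 2)
        have q1 := h (1 + (m - 3) + 2)
        have q2 := h (2 + (m - 3) + 2)
        have := seven_le (by omega) (Nat.div_le_div_right (Nat.le_add_right b u))
          (by omega : levels m 0 (b / 2 ^ (m - 3)) ((b + u) / 2 ^ (m - 3)) % 4 = 0)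
          (by omega) (by omega)
        have p : 2 ^ (m - 2) = 2 * 2 ^ (m - 3) := by
          rw [← Nat.pow_succ']; congr 1; omega
        have hp : 0 < 2 ^ (m - 3) := by positivity
        rw [p]
        generalize 2 ^ (m - 3) = P at *
        have d1 := Nat.div_add_mod b P
        have d2 := Nat.div_mul_le_self (b + u) P
        have d3 := Nat.mod_lt b hp
        have d4 : (7 + b / P) * P ≤ (b + u) / P * P := Nat.mul_le_mul_right P (by omega)
        rw [Nat.add_mul, Nat.mul_comm (b / P)] at d4
        omega
      · rw [show 2 + (m - 3) + 1 = m by omega, Nat.mod_self]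
      · rw [show 2 + (m - 3) + 2 = m + 1 by omega, Nat.add_mod_left,
          Nat.mod_eq_of_lt (by omega)]
        omega
    · rw [Nat.mod_eq_of_lt (by omega)]; omega
    · rw [show 1 + (m - 3) + 2 = m by omega, Nat.mod_self]
  · rw [Nat.mod_eq_of_lt (by omega)]; omega
  · rw [Nat.mod_eq_of_lt (by omega)]; omega

theorem window_large_pow {m u : ℕ} (hm : 8 ≤ m) (hu : u % 2 = 1) (k a : ℕ)
    (h : ∀ r, levels m r a (a + 2 ^ k * 4 * u) % 4 = 0) : 3 * 2 ^ (m - 2) < u := by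
  induction k generalizing a with
  | zero => exact window_large hm hu a (by simpa using h)
  | succ k ih =>
    refine ih (a / 2) fun r => ?_
    have h1 := h (r + 1)
    have h2 := odds_eq (Nat.le_add_right a (2 ^ (k + 1) * 4 * u))
    have h3 : 2 ^ (k + 1) * 4 * u = 8 * (2 ^ k * u) := by ring
    have h4 : 2 ^ k * 4 * u = 4 * (2 ^ k * u) := by ring
    rw [levels_succ, h3, show (a + 8 * (2 ^ k * u)) / 2 = a / 2 + 4 * (2 ^ k * u) by omega] at h1
    rw [h4]
    rw [h3] at h2
    split_ifs at h1 <;> omega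

theorem letter_bounds {M t : ℕ} (hM : 56 ≤ M) (ht : t < letters M) :
    1 < letter M t ∧ letter M t + 1 ≤ M / 4 ∧ letter M t ≠ M / 8 + 1 := by
  unfold letter letters at *
  split_ifs <;> omega

theorem letter_inj {M t t' : ℕ} (h : letter M t = letter M t') : t = t' := by
  unfold letter at h
  split_ifs at h <;> omega

theorem active_letter {M r x : ℕ} (hM : 56 ≤ M) :
    Active M (letter M (r % letters M)) x ↔ padicValNat 2 x % letters M = r % letters M := by
  have hm : 0 < letters M := by unfold letters; omega
  obtain ⟨h1, -, h3⟩ := letter_bounds hM (Nat.mod_lt r hm)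
  unfold Active
  constructor
  · rintro (h | h | h)
    · omega
    · omega
    · exact (letter_inj h).symm
  · intro h
    rw [h]
    exact Or.inr (Or.inr rfl)

theorem turns_letter {M : ℕ} (hM : 56 ≤ M) (r a j : ℕ) :
    turns M (letter M (r % letters M)) (a + j) - turns M (letter M (r % letters M)) a =
      levels (letters M) r a (a + j) := by
  have : Finset.Ioc 0 (a + j) = Finset.Ioc 0 a ∪ Finset.Ioc a (a + j) := by
    ext t; simp only [Finset.mem_Ioc, Finset.mem_union]; omega
  unfold turns levels
  rw [this, Finset.filter_union, Finset.card_union_of_disjoint, Nat.add_sub_cancel_left]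
  · simp only [active_letter hM]
  · refine Finset.disjoint_filter_filter (Finset.disjoint_left.2 fun t => ?_)
    simp only [Finset.mem_Ioc]
    omega

theorem valuation_two_pow_mul (k : ℕ) {w : ℕ} (h : 0 < w) :
    padicValNat 2 (2 ^ k * w) = k + padicValNat 2 w := by
  rw [padicValNat.mul (by positivity) (by omega), padicValNat.prime_pow]

theorem valuation_of_mod_four {w : ℕ} (h : w % 4 = 2) : padicValNat 2 w = 1 := by
  obtain ⟨v, rfl⟩ : ∃ v, w = 2 * v := ⟨w / 2, by omega⟩
  rw [valuation_two_mul (by omega), valuation_odd (by omega)]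

/-- The valuation is not periodic on long intervals. -/
theorem exists_valuation_ne {m k u x : ℕ} (hm : 2 ≤ m) (hu : u % 2 = 1)
    (h : ∀ y, x < y → y ≤ x + 3 * 2 ^ k →
      padicValNat 2 y % m = padicValNat 2 (y + 2 ^ k * u) % m) : False := by
  have hp : 0 < 2 ^ k := by positivity
  have d1 := Nat.div_add_mod x (2 ^ k)
  have d2 := Nat.mod_lt x hp
  have g : ∀ w, x / 2 ^ k < w → w ≤ x / 2 ^ k + 3 →
      padicValNat 2 w % m = padicValNat 2 (w + u) % m := by
    intro w h1 h2
    have l1 : 2 ^ k * (x / 2 ^ k + 1) ≤ 2 ^ k * w := Nat.mul_le_mul_left _ h1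
    have l2 : 2 ^ k * w ≤ 2 ^ k * (x / 2 ^ k + 3) := Nat.mul_le_mul_left _ h2
    rw [Nat.mul_add] at l1 l2
    have h0 : 0 < w := Nat.zero_lt_of_lt h1
    have := h (2 ^ k * w) (by omega) (by omega)
    rw [← Nat.mul_add, valuation_two_pow_mul k h0, valuation_two_pow_mul k (by omega)] at this
    exact Nat.ModEq.add_left_cancel' k this
  have c : ∀ w, x / 2 ^ k < w → w ≤ x / 2 ^ k + 3 → w % 4 ≠ 2 ∧ (w + u) % 4 ≠ 2 := by
    intro w h1 h2
    have e := g w h1 h2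
    constructor
    · intro h4
      rw [valuation_of_mod_four h4, valuation_odd (by omega), Nat.mod_eq_of_lt (by omega)] at e
      simp at e
    · intro h4
      rw [valuation_of_mod_four h4, valuation_odd (by omega), Nat.mod_eq_of_lt (by omega : 1 < m)] at e
      simp at e
  have c1 := c (x / 2 ^ k + 1) (by omega) (by omega)
  have c2 := c (x / 2 ^ k + 2) (by omega) (by omega)
  have c3 := c (x / 2 ^ k + 3) (by omega) (by omega)
  omega

theorem le_two_pow_letters {M : ℕ} (hM : 56 ≤ M) : M ≤ 2 ^ (letters M - 2) := by
  have : ∀ n, 8 ≤ n → 4 * n + 27 ≤ 2 ^ (n - 2) := by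
    intro n hn
    induction n, hn using Nat.le_induction with
    | base => norm_num
    | succ n hn ih =>
      rw [show n + 1 - 2 = (n - 2) + 1 by omega, Nat.pow_succ]
      omega
  have := this (letters M) (by unfold letters; omega)
  unfold letters at *
  omega

/-- If consecutive blocks show the same permutations as those `j` blocks later, then `j` is
large. -/
theorem shift_large {M j x z : ℕ} (hM : 56 ≤ M) (hj : 4 ∣ j) (hj' : 0 < j)
    (H : ∀ s ≤ z, ∀ y, 1 ≤ y → y + 1 ≤ M / 4 →
      (turns M y (x + s + j) - turns M y (x + s)) % 4 = 0) : M * z + M + 4 ≤ j := by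
  have hm : 8 ≤ letters M := by unfold letters; omega
  obtain ⟨k, u, hu, rfl⟩ := Nat.exists_eq_two_pow_mul_odd (by omega : j ≠ 0)
  have hu' : u % 2 = 1 := Nat.odd_iff.1 hu
  obtain ⟨k, rfl⟩ : ∃ l, k = l + 2 := by
    refine ⟨k - 2, ?_⟩
    by_contra hk
    obtain rfl | rfl : k = 0 ∨ k = 1 := by omega
    all_goals omega
  have lb : ∀ r, 1 ≤ letter M (r % letters M) ∧ letter M (r % letters M) + 1 ≤ M / 4 := by
    intro r
    have := letter_bounds hM (Nat.mod_lt r (by omega : letters M > 0))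
    omega
  have h1 : 3 * 2 ^ (letters M - 2) < u := by
    refine window_large_pow hm hu' k x fun r => ?_
    have := H 0 (by omega) _ (lb r).1 (lb r).2
    rwa [Nat.add_zero, turns_letter hM, pow_add] at this
  have h2 : z < 3 * 2 ^ (k + 2) := by
    by_contra hz
    refine exists_valuation_ne (x := x) (by omega : 2 ≤ letters M) hu' (k := k + 2) fun y h1 h2 => ?_
    obtain ⟨s, rfl⟩ : ∃ s, y = x + s + 1 := ⟨y - x - 1, by omega⟩
    have hs : s + 1 ≤ z := by omega
    generalize 2 ^ (k + 2) * u = j at *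
    set r := padicValNat 2 (x + s + 1) with hr
    have a0 := H s (by omega) _ (lb r).1 (lb r).2
    have a1 := H (s + 1) hs _ (lb r).1 (lb r).2
    have b0 := turns_mono M (letter M (r % letters M)) (Nat.le_add_right (x + s) j)
    have b1 := turns_mono M (letter M (r % letters M)) (Nat.le_add_right (x + s + 1) j)
    rw [← Nat.add_assoc x s 1, Nat.add_right_comm (x + s) 1 j, turns_succ, turns_succ,
      if_pos ((active_letter hM).2 rfl)] at a1
    rw [Nat.add_right_comm (x + s) 1 j, turns_succ, turns_succ,
      if_pos ((active_letter hM).2 rfl)] at b1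
    have act : Active M (letter M (r % letters M)) (x + s + j + 1) := by
      by_contra hn
      rw [if_neg hn] at a1 b1
      omega
    rw [Nat.add_right_comm (x + s) 1 j]
    exact ((active_letter hM).1 act).symm
  have h3 := le_two_pow_letters hM
  have h4 : 4 ≤ 2 ^ (k + 2) := by
    rw [pow_add]; have : 0 < 2 ^ k := by positivity
    omega
  generalize 2 ^ (k + 2) = P at *
  calc M * z + M + 4 = M * (z + 1) + 4 := by ring
    _ ≤ M * (3 * P) + P := Nat.add_le_add (Nat.mul_le_mul_left _ h2) h4
    _ = P * (3 * M + 1) := by ring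
    _ ≤ P * u := Nat.mul_le_mul_left _ (by omega)

theorem turns_of_block {M j x P : ℕ} (hM : 56 ≤ M) (h1 : x * (M * ring M) ≤ P)
    (h2 : P + M ≤ (x + 1) * (M * ring M))
    (H : ∀ k < M, val M (P + k) = val M (P + k + j * ring M * M)) {y : ℕ} (hy : 1 ≤ y)
    (hy' : y + 1 ≤ M / 4) : (turns M y (x + j) - turns M y x) % 4 = 0 := by
  have hP := Nat.mod_lt P (by omega : M > 0)
  obtain ⟨k, hk, e⟩ : ∃ k < M, (P + k) % M + 1 = 4 * y + 0 := by
    by_cases h : P % M ≤ 4 * y - 1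
    · refine ⟨4 * y - 1 - P % M, by omega, ?_⟩
      rw [(div_mod_add_lt (by omega)).2]
      omega
    · refine ⟨4 * y - 1 + M - P % M, by omega, ?_⟩
      have := div_mod_add (by omega : 0 < M) P (4 * y - 1 + M - P % M)
      rw [Nat.mod_eq_of_lt (by omega : 4 * y - 1 + M - P % M < M)] at this
      have := Nat.mod_lt (P + (4 * y - 1 + M - P % M)) (by omega : M > 0)
      omega
  have := turns_of_match (by omega) (by norm_num) rfl e (H k hk)
  rwa [Nat.div_div_eq_div_mul, Nat.div_eq_of_lt_le (by omega : x * (M * ring M) ≤ P + k)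
    (by omega)] at this

theorem run_le_of_four_dvd {M p j : ℕ} (hM : 56 ≤ M) (hj : 4 ∣ j) (hj' : 0 < j)
    (H : ∀ k ≤ j * ring M, val M (p + k) = val M (p + k + j * ring M * M)) : False := by
  have hrM : 2 * ring M = M + 2 ∨ 2 * ring M = M + 3 := by unfold ring; omega
  have hz := Nat.div_add_mod (j - 4) M
  have hz' := Nat.mod_lt (j - 4) (by omega : M > 0)
  set z := (j - 4) / M
  have key : ∀ x, (∀ s ≤ z, ∃ P, p ≤ P ∧ (x + s) * (M * ring M) ≤ P ∧
      P + M ≤ (x + s + 1) * (M * ring M) ∧ P + M ≤ p + j * ring M + 1) → False := by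
    intro x h
    have := shift_large (x := x) (z := z) hM hj hj' fun s hs y hy hy' => by
      obtain ⟨P, h0, h1, h2, h3⟩ := h s hs
      refine turns_of_block hM h1 h2 (fun k hk => ?_) hy hy'
      have := H (P - p + k) (by omega)
      rwa [show p + (P - p + k) = P + k by omega] at this
    omega
  have hs : ∀ s ≤ z, s * (M * ring M) + 4 * ring M ≤ j * ring M := by
    intro s hs
    have : s * M ≤ j - 4 := (Nat.mul_le_mul_right M hs).trans (by rw [Nat.mul_comm]; omega)
    rw [← Nat.mul_assoc, ← Nat.add_mul]
    exact Nat.mul_le_mul_right _ (by omega)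
  have d1 := Nat.div_add_mod p (M * ring M)
  have d2 := Nat.mod_lt p (Nat.mul_pos (by omega : 0 < M) (ring_pos M))
  have d3 : M * 1 ≤ M * ring M := Nat.mul_le_mul_left _ (ring_pos M)
  rw [Nat.mul_comm] at d1
  by_cases hr : p % (M * ring M) + M ≤ M * ring M
  · refine key (p / (M * ring M)) fun s h => ?_
    have := hs s h
    refine ⟨max p ((p / (M * ring M) + s) * (M * ring M)), le_max_left _ _, le_max_right _ _, ?_, ?_⟩
    · rw [Nat.add_mul _ 1, Nat.add_mul]
      omega
    · rw [Nat.add_mul]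
      omega
  · refine key (p / (M * ring M) + 1) fun s h => ?_
    have := hs s h
    refine ⟨(p / (M * ring M) + 1 + s) * (M * ring M), ?_, le_rfl, ?_, ?_⟩ <;>
    simp only [Nat.add_mul] <;> omega

theorem mul_le_of_run {M p q e : ℕ} (hM : 56 ≤ M) (hq : 1 ≤ q)
    (H : ∀ k < e, val M (p + k) = val M (p + k + q)) : e * M ≤ q := by
  suffices e ≤ q / M from (Nat.mul_le_mul_right M this).trans (Nat.div_mul_le_self q M)
  by_contra he
  have d1 := Nat.div_add_mod q M
  have d2 := Nat.mod_lt q (by omega : M > 0)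
  have d3 : ∀ t, t = 0 ∨ t = 1 ∨ 2 ≤ t ∧ t < 15 ∨ 15 ≤ t := by omega
  rcases d3 (q / M) with h | h | ⟨h, h'⟩ | h
  · rw [h] at d1
    exact run_lt_one hM hq (by omega) (H 0 (by omega))
  · rw [h] at d1
    exact run_lt_two hM (by omega) (by omega) (H 0 (by omega)) (H 1 (by omega))
  · exact run_lt_three hM ((Nat.le_div_iff_mul_le (by omega)).1 h)
      ((Nat.div_lt_iff_lt_mul (by omega)).1 h') (H 0 (by omega)) (H 1 (by omega))
      (H 2 (by omega))
  · by_cases hg : q % M = 0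
    · obtain ⟨t, rfl⟩ : ∃ t, q = t * M := ⟨q / M, by rw [Nat.mul_comm]; omega⟩
      rw [Nat.mul_div_cancel _ (by omega)] at *
      by_cases hr : ring M ∣ t
      · obtain ⟨j, rfl⟩ := hr
        rw [Nat.mul_comm (ring M) j] at *
        have hj : 0 < j := Nat.pos_of_ne_zero fun e => by simp [e] at h
        by_cases hj4 : 4 ∣ j
        · exact run_le_of_four_dvd hM hj4 hj fun k hk => H k (by omega)
        · have := Nat.mul_le_mul_right (ring M) hj
          exact run_le_ring hM hj4 fun k hk => H k (by omega)
      · exact run_lt_seven hM hr fun k hk => H k (by omega)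
    · exact run_lt_six hM hg fun k hk => H k (by omega)

/-- The letter at position `p`. -/
def word (M p : ℕ) : Fin (M + 1) := ⟨min (val M p - 1) M, by omega⟩

theorem val_eq_of_word_eq {M p p' : ℕ} (hM : 56 ≤ M) (h : word M p = word M p') :
    val M p = val M p' := by
  have hrM : 2 * ring M = M + 2 ∨ 2 * ring M = M + 3 := by unfold ring; omega
  have h1 := value_bounds (R := p / M) hM (Nat.mod_lt p (by omega))
  have h2 := value_bounds (R := p' / M) hM (Nat.mod_lt p' (by omega))
  have h3 : min (val M p - 1) M = min (val M p' - 1) M := congrArg Fin.val h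
  unfold val at *
  omega

end Large

theorem avoidable_of_large {M : ℕ} (hM : 56 ≤ M) : Avoidable (M + 1) 1 M := by
  refine ⟨Large.word M, fun p q e hq hm => ?_⟩
  rw [Nat.mul_one]
  refine Large.mul_le_of_run (p := p) hM hq fun k hk => ?_
  rw [Nat.add_right_comm]
  exact Large.val_eq_of_word_eq hM (hm k hk)

theorem avoidable_of_five_le {n : ℕ} (hn : 5 ≤ n) : Avoidable n 1 (n - 1) := by
  by_cases h : 57 ≤ n
  · obtain ⟨M, rfl⟩ : ∃ M, n = M + 1 := ⟨n - 1, by omega⟩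
    exact avoidable_of_large (by omega)
  · have : n ≤ 56 := by omega
    interval_cases n
    exacts [avoidable_5, avoidable_6, avoidable_7, avoidable_8, avoidable_9, avoidable_10,
      avoidable_11, avoidable_12, avoidable_13, avoidable_14, avoidable_15, avoidable_16,
      avoidable_17, avoidable_18, avoidable_19, avoidable_20, avoidable_21, avoidable_22,
      avoidable_23, avoidable_24, avoidable_25, avoidable_26, avoidable_27, avoidable_28,
      avoidable_29, avoidable_30, avoidable_31, avoidable_32, avoidable_33, avoidable_34,
      avoidable_35, avoidable_36, avoidable_37, avoidable_38, avoidable_39, avoidable_40,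
      avoidable_41, avoidable_42, avoidable_43, avoidable_44, avoidable_45, avoidable_46,
      avoidable_47, avoidable_48, avoidable_49, avoidable_50, avoidable_51, avoidable_52,
      avoidable_53, avoidable_54, avoidable_55, avoidable_56]

theorem exists_word_of_avoidable {n num den : ℕ} (h : Avoidable n num den) (hd : 0 < den)
    (hRT : RT n * den = den + num) :
    ∃ w : ℕ → Fin n, ∀ i L q : ℕ, 1 ≤ q → HasPeriodL (wordOf w i L) q →
      (L : ℚ) ≤ (q : ℚ) * RT n := by
  obtain ⟨w, hw⟩ := h
  refine ⟨w, fun i L q hq hp => ?_⟩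
  have hm : Match w i q (L - q) := by
    intro k hk
    have := hp k (by simp only [wordOf, List.length_map, List.length_range]; omega)
    simp only [wordOf, List.getElem?_map] at this
    rw [List.getElem?_range (by omega), List.getElem?_range (by omega)] at this
    rw [Nat.add_right_comm, Nat.add_assoc]
    exact Option.some_injective _ this
  have h1 : L * den ≤ q * (den + num) := by
    calc L * den ≤ (q + (L - q)) * den := Nat.mul_le_mul_right _ (by omega)
      _ = q * den + (L - q) * den := Nat.add_mul _ _ _
      _ ≤ q * den + q * num := Nat.add_le_add_left (hw i q (L - q) hq hm) _
      _ = q * (den + num) := (Nat.mul_add _ _ _).symm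
  have h2 : (L : ℚ) * den ≤ q * (den + num) := by exact_mod_cast h1
  rw [← hRT, ← mul_assoc] at h2
  exact le_of_mul_le_mul_right h2 (by exact_mod_cast hd)

end Dejean

/-- The avoidance direction of Dejean's conjecture, for all `n ≥ 2`: there is an infinite
word over an `n`-letter alphabet every factor of which having a period `q ≥ 1` has length
at most `q·RT(n)`. -/
theorem dejean_avoidance (n : ℕ) (hn : 2 ≤ n) :
    ∃ w : ℕ → Fin n, ∀ i L q : ℕ, 1 ≤ q → HasPeriodL (wordOf w i L) q →
      (L : ℚ) ≤ (q : ℚ) * RT n := by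
  obtain rfl | rfl | rfl | h : n = 2 ∨ n = 3 ∨ n = 4 ∨ 5 ≤ n := by omega
  · exact Dejean.exists_word_of_avoidable Dejean.avoidable_two one_pos (by norm_num [RT])
  · exact Dejean.exists_word_of_avoidable Dejean.avoidable_3 four_pos (by norm_num [RT])
  · exact Dejean.exists_word_of_avoidable Dejean.avoidable_4 (by norm_num) (by norm_num [RT])
  · refine Dejean.exists_word_of_avoidable (Dejean.avoidable_of_five_le h) (by omega) ?_
    have h1 : (n : ℚ) - 1 ≠ 0 := by
      have : (5 : ℚ) ≤ n := by exact_mod_cast h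
      linarith
    rw [RT, if_neg (by omega), if_neg (by omega), if_neg (by omega), Nat.cast_sub (by omega)]
    push_cast
    field_simp
    ring
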